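/- arXiv:2404.00059 — 6 statements merged into one kernel-verified Lean document; each statement's English description precedes it below -/
import Mathlib

section
/- Let X, Y : ℝ^n → ℝ^n be smooth (C^∞) vector fields admitting global flows φ and ψ respectively, let Z = [X,Y] be their Lie bracket, and suppose Z admits a global flow ζ. Then for every p ∈ ℝ^n, the commutator of flows satisfies ψ(-t, φ(-t, ψ(t, φ(t, p)))) = ζ(t², p) + o(t²) as t → 0; that is, the function t ↦ ψ(-t, φ(-t, ψ(t, φ(t, p)))) - ζ(t², p) is o(t²) at t = 0. -/
open Asymptotics

section FlowAux
open Filter Topology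

variable {E : Type*} [NormedAddCommGroup E] [NormedSpace ℝ E]

theorem flowAux_conf_fwd (γ V : ℝ → E) (hγ : ∀ s, HasDerivAt γ (V s) s) (M δ : ℝ) (hM : 0 < M)
    (hV : ∀ s, ‖γ s - γ 0‖ ≤ M * δ → ‖V s‖ < M) :
    ∀ s ∈ Set.Icc 0 δ, ‖γ s - γ 0‖ ≤ M * s := by
  intro s hs
  refine image_norm_le_of_norm_deriv_right_lt_deriv_boundary (f := fun s => γ s - γ 0) (f' := V)
    (a := 0) (b := δ) (B := fun s => M * s) (B' := fun _ => M) ?_ ?_ ?_ ?_ ?_ hs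
  · exact fun x _ => ((hγ x).continuousAt.sub continuousAt_const).continuousWithinAt
  · exact fun x _ => ((hγ x).sub_const _).hasDerivWithinAt
  · simp
  · intro x
    simpa using (hasDerivAt_id x).const_mul M
  · intro x hx h
    apply hV
    have h' : ‖γ x - γ 0‖ = M * x := h
    rw [h']
    exact mul_le_mul_of_nonneg_left hx.2.le hM.le

theorem flowAux_conf (γ V : ℝ → E) (hγ : ∀ s, HasDerivAt γ (V s) s) (M δ : ℝ) (hM : 0 < M)
    (hV : ∀ s, ‖γ s - γ 0‖ ≤ M * δ → ‖V s‖ < M) (s : ℝ) (hs : |s| ≤ δ) :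
    ‖γ s - γ 0‖ ≤ M * |s| := by
  rcases le_total 0 s with h | h
  · rw [abs_of_nonneg h] at hs ⊢
    exact flowAux_conf_fwd γ V hγ M δ hM hV s ⟨h, hs⟩
  · rw [abs_of_nonpos h] at hs ⊢
    have := flowAux_conf_fwd (fun s => γ (-s)) (fun s => - V (-s)) (fun s => by
      have := (hγ (-s)).scomp s (hasDerivAt_neg s)
      simpa [Function.comp_def] using this) M δ hM (by
        intro s hs
        rw [norm_neg]
        exact hV _ (by simpa using hs)) (-s) ⟨by linarith, hs⟩
    simpa using this

theorem flowAux_mv (g g' : ℝ → E) (t C : ℝ) (hg : ∀ s, HasDerivAt g (g' s) s) (h0 : g 0 = 0)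
    (hb : ∀ s, |s| ≤ |t| → ‖g' s‖ ≤ C) : ‖g t‖ ≤ C * |t| := by
  have := (convex_Icc (-|t|) |t|).norm_image_sub_le_of_norm_hasDerivWithin_le
    (f := g) (f' := g') (C := C) (x := 0) (y := t)
    (fun x _ => (hg x).hasDerivWithinAt) (fun x hx => hb x (abs_le.2 hx))
    (by constructor <;> simp) (abs_le.1 le_rfl)
  simpa [h0] using this

theorem flowAux_unif (X : E → E) (A : E →L[ℝ] E) (p : E) (hA : HasStrictFDerivAt X A p)
    (φ : ℝ → E → E) (hφ0 : ∀ p, φ 0 p = p)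
    (hφ : ∀ t p, HasDerivAt (fun s => φ s p) (X (φ t p)) t) :
    (fun z : ℝ × E => φ z.1 z.2 - z.2 - z.1 • X z.2 - (z.1 ^ 2 / 2) • A (X z.2))
      =o[𝓝 ((0 : ℝ), p)] (fun z => z.1 ^ 2) := by
  set M : ℝ := ‖X p‖ + 1 with hMd
  have hM : 0 < M := by positivity
  rw [isLittleO_iff]
  intro c hc
  -- choose ε
  set ε : ℝ := c / (2 * M) with hε
  have hεp : 0 < ε := by positivity
  have h1 : ∀ᶠ z : E × E in 𝓝 (p, p), ‖X z.1 - X z.2 - A (z.1 - z.2)‖ ≤ ε * ‖z.1 - z.2‖ :=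
    hA.isLittleO.def hεp
  have h2 : ∀ᶠ y in 𝓝 p, ‖X y‖ < M := by
    have : ContinuousAt (fun y => ‖X y‖) p := hA.hasFDerivAt.continuousAt.norm
    exact this.eventually_lt continuousAt_const (by simp [hMd])
  obtain ⟨r₁, hr₁, H1⟩ := Metric.eventually_nhds_iff.1 h1
  obtain ⟨r₂, hr₂, H2⟩ := Metric.eventually_nhds_iff.1 h2
  set r := min r₁ r₂ with hr
  have hrp : 0 < r := lt_min hr₁ hr₂
  have HX : ∀ y, dist y p < r → ‖X y‖ < M := fun y hy => H2 (hy.trans_le (min_le_right _ _))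
  have HA : ∀ y z, dist y p < r → dist z p < r →
      ‖X y - X z - A (y - z)‖ ≤ ε * ‖y - z‖ := by
    intro y z hy hz
    refine H1 (y := (y, z)) ?_
    rw [Prod.dist_eq]
    exact max_lt (hy.trans_le (min_le_left _ _)) (hz.trans_le (min_le_left _ _))
  set K := ‖A‖ + ε with hK
  have hKp : 0 < K := by positivity
  set δ := min (r / (4 * M)) (c / (2 * (‖A‖ * K * M + 1))) with hδ
  have hδp : 0 < δ := by positivity
  have hev : ∀ᶠ z : ℝ × E in 𝓝 ((0 : ℝ), p), |z.1| < δ ∧ dist z.2 p < r / 2 := by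
    rw [nhds_prod_eq]
    refine Filter.Eventually.prod_mk (pa := fun t : ℝ => |t| < δ) ?_
      (pb := fun y : E => dist y p < r / 2) ?_
    · filter_upwards [Metric.ball_mem_nhds (0 : ℝ) hδp] with t ht
      simpa using ht
    · exact Metric.ball_mem_nhds p (half_pos hrp)
  filter_upwards [hev]
  rintro ⟨t, q⟩ ⟨ht, hq⟩
  simp only at ht hq ⊢
  have hqr : dist q p < r := by linarith
  have hMδ : M * δ ≤ r / 4 := by
    calc M * δ ≤ M * (r / (4 * M)) := mul_le_mul_of_nonneg_left (min_le_left _ _) hM.le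
      _ = r / 4 := by field_simp
  have hnear : ∀ y, ‖y - q‖ ≤ M * δ → dist y p < r := by
    intro y hy
    rw [← dist_eq_norm] at hy
    linarith [dist_triangle y q p]
  have c1 : ∀ s, |s| ≤ δ → ‖φ s q - q‖ ≤ M * |s| := by
    intro s hs
    have := flowAux_conf (fun s => φ s q) (fun s => X (φ s q)) (fun s => hφ s q) M δ hM
      (fun s hs => HX _ (hnear _ (by simpa [hφ0] using hs))) s hs
    simpa [hφ0] using this
  have c2 : ∀ s, |s| ≤ δ → dist (φ s q) p < r := fun s hs =>
    hnear _ ((c1 s hs).trans (mul_le_mul_of_nonneg_left hs hM.le))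
  have c3 : ∀ s, |s| ≤ δ → ‖X (φ s q) - X q - A (φ s q - q)‖ ≤ ε * (M * |s|) := fun s hs =>
    (HA _ _ (c2 s hs) hqr).trans (mul_le_mul_of_nonneg_left (c1 s hs) hεp.le)
  have c4 : ∀ s, |s| ≤ δ → ‖X (φ s q) - X q‖ ≤ K * (M * |s|) := by
    intro s hs
    have e : X (φ s q) - X q = (X (φ s q) - X q - A (φ s q - q)) + A (φ s q - q) := by abel
    rw [e]
    refine (norm_add_le _ _).trans ?_
    have := (A.le_opNorm (φ s q - q)).trans
      (mul_le_mul_of_nonneg_left (c1 s hs) (norm_nonneg A))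
    rw [hK, add_mul]
    linarith [c3 s hs]
  have c5 : ∀ s, |s| ≤ δ → ‖φ s q - q - s • X q‖ ≤ K * (M * |s|) * |s| := by
    intro s hs
    refine flowAux_mv (fun s => φ s q - q - s • X q) (fun s => X (φ s q) - X q) s _ ?_ ?_ ?_
    · intro u
      have h := ((hφ u q).sub_const q).sub ((hasDerivAt_id u).smul_const (X q))
      simp only [id, one_smul] at h
      exact h
    · simp [hφ0]
    · intro u hu
      refine (c4 u (hu.trans hs)).trans ?_
      gcongr
  have c6 : ‖φ t q - q - t • X q - (t ^ 2 / 2) • A (X q)‖ ≤ (c * |t|) * |t| := by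
    refine flowAux_mv (fun s => φ s q - q - s • X q - (s ^ 2 / 2) • A (X q))
      (fun s => X (φ s q) - X q - s • A (X q)) t _ ?_ ?_ ?_
    · intro u
      have h1 : HasDerivAt (fun s : ℝ => s ^ 2 / 2) u u := by
        have := ((hasDerivAt_id u).pow 2).div_const 2
        simpa using this
      have h := (((hφ u q).sub_const q).sub ((hasDerivAt_id u).smul_const (X q))).sub
        (h1.smul_const (A (X q)))
      simp only [id, one_smul] at h
      exact h
    · simp [hφ0]
    · intro s hs
      have hsδ : |s| ≤ δ := hs.trans ht.le
      have e : X (φ s q) - X q - s • A (X q) =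
          (X (φ s q) - X q - A (φ s q - q)) + A (φ s q - q - s • X q) := by
        simp only [map_sub, map_smul]
        abel
      rw [e]
      refine (norm_add_le _ _).trans ?_
      have a1 := (A.le_opNorm (φ s q - q - s • X q)).trans
        (mul_le_mul_of_nonneg_left (c5 s hsδ) (norm_nonneg A))
      have a2 := c3 s hsδ
      have a3 : ε * M = c / 2 := by rw [hε]; field_simp
      have a4 : (‖A‖ * K * M) * |s| ≤ c / 2 := by
        have hB : 0 ≤ ‖A‖ * K * M := by positivity
        calc (‖A‖ * K * M) * |s| ≤ (‖A‖ * K * M + 1) * (c / (2 * (‖A‖ * K * M + 1))) := by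
              gcongr
              · linarith
              · exact hsδ.trans (min_le_right _ _)
          _ = c / 2 := by field_simp
      have a5 : ε * (M * |s|) + ‖A‖ * (K * (M * |s|) * |s|)
          = (ε * M + (‖A‖ * K * M) * |s|) * |s| := by ring
      have a6 : (ε * M + (‖A‖ * K * M) * |s|) * |s| ≤ c * |t| := by
        refine mul_le_mul ?_ hs (abs_nonneg _) hc.le
        linarith
      linarith
  refine c6.trans (le_of_eq ?_)
  rw [Real.norm_eq_abs, abs_pow]
  ring

theorem flowAux_exp (X : E → E) (A : E →L[ℝ] E) (p : E) (hA : HasStrictFDerivAt X A p)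
    (φ : ℝ → E → E) (hφ0 : ∀ p, φ 0 p = p)
    (hφ : ∀ t p, HasDerivAt (fun s => φ s p) (X (φ t p)) t) (c : ℝ) (q : ℝ → E) (a b : E)
    (hq : (fun t : ℝ => q t - p - t • a - t ^ 2 • b) =o[𝓝 0] (fun t : ℝ => t ^ 2)) :
    (fun t : ℝ => φ (c * t) (q t) - p - t • (a + c • X p)
      - t ^ 2 • (b + c • A a + (c ^ 2 / 2) • A (X p))) =o[𝓝 0] (fun t : ℝ => t ^ 2) := by
  have hid : Tendsto (fun t : ℝ => t) (𝓝 0) (𝓝 0) := tendsto_id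
  have hsq : (fun t : ℝ => t ^ 2) =o[𝓝 0] (fun t : ℝ => t) := by
    simpa using isLittleO_pow_id (𝕜 := ℝ) (n := 2) (by norm_num)
  have hq1 : (fun t : ℝ => q t - p - t • a) =O[𝓝 0] (fun t : ℝ => t ^ 2) := by
    have h := hq.isBigO.add (f₂ := fun t : ℝ => t ^ 2 • b) (IsBigO.of_bound ‖b‖ (by
      filter_upwards with t
      rw [norm_smul, mul_comm]))
    refine h.congr_left fun t => by abel
  have hq2 : (fun t : ℝ => q t - p) =O[𝓝 0] (fun t : ℝ => t) := by
    have h := (hq1.trans hsq.isBigO).add (f₂ := fun t : ℝ => t • a) (IsBigO.of_bound ‖a‖ (by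
      filter_upwards with t
      rw [norm_smul, mul_comm]))
    refine h.congr_left fun t => by abel
  have hqt : Tendsto q (𝓝 0) (𝓝 p) := by
    have := (hq2.trans_tendsto hid).add_const p
    simpa using this
  have hmul : ∀ (u : ℝ → E), u =o[𝓝 0] (fun t : ℝ => t) →
      (fun t : ℝ => (c * t) • u t) =o[𝓝 0] (fun t : ℝ => t ^ 2) := by
    intro u hu
    have := (isBigO_const_mul_self c (fun t : ℝ => t) (𝓝 0)).smul_isLittleO hu
    simpa [sq] using this
  have e1 := (flowAux_unif X A p hA φ hφ0 hφ).comp_tendsto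
    (k := fun t : ℝ => (c * t, q t)) (l' := 𝓝 0) (by
      rw [nhds_prod_eq]
      refine Tendsto.prodMk ?_ hqt
      simpa using hid.const_mul c)
  have e1' : (fun t : ℝ => φ (c * t) (q t) - q t - (c * t) • X (q t)
      - ((c * t) ^ 2 / 2) • A (X (q t))) =o[𝓝 0] (fun t : ℝ => t ^ 2) := by
    refine IsLittleO.trans_isBigO e1 ?_
    refine IsBigO.of_bound (c ^ 2) ?_
    filter_upwards with t
    simp [mul_pow]
  have e3 : (fun t : ℝ => X (q t) - X p - A (q t - p)) =o[𝓝 0] (fun t : ℝ => t) :=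
    (hA.hasFDerivAt.isLittleO.comp_tendsto hqt).trans_isBigO hq2
  have e4 : (fun t : ℝ => A (q t - p - t • a)) =o[𝓝 0] (fun t : ℝ => t) :=
    ((A.isBigO_comp _ _).trans hq1).trans_isLittleO hsq
  have e5 : (fun t : ℝ => t • A (X (q t) - X p)) =o[𝓝 0] (fun t : ℝ => t) := by
    have h : (fun t : ℝ => A (X (q t) - X p)) =o[𝓝 0] (fun _ : ℝ => (1 : ℝ)) := by
      rw [isLittleO_one_iff]
      have h0 : Tendsto (fun t => X (q t) - X p) (𝓝 0) (𝓝 0) := by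
        simpa using (hA.hasFDerivAt.continuousAt.tendsto.comp hqt).sub_const (X p)
      have h3 := (A.continuous.tendsto 0).comp h0
      rw [map_zero] at h3
      exact h3
    simpa using (isBigO_refl (fun t : ℝ => t) (𝓝 0)).smul_isLittleO h
  have tot := (((e1'.add hq).add (hmul _ e3)).add (hmul _ e4)).add (hmul _ (e5.const_smul_left (c / 2)))
  refine tot.congr_left fun t => ?_
  simp only [map_sub, map_smul, Pi.smul_apply]
  module

end FlowAux

/-- **The fundamental fact about Lie brackets.** If `X, Y` are smooth vector fields on `ℝⁿ`
with global flows `φ, ψ`, and the Lie bracket `Z = [X,Y]` has global flow `ζ`, then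
`ψ(-t, φ(-t, ψ(t, φ(t, p)))) = ζ(t², p) + o(t²)` as `t → 0`. -/
theorem flow_commutator_isLittleO {n : ℕ} (X Y : (Fin n → ℝ) → (Fin n → ℝ))
    (hX : ContDiff ℝ (⊤ : ℕ∞) X) (hY : ContDiff ℝ (⊤ : ℕ∞) Y)
    (φ ψ ζ : ℝ → (Fin n → ℝ) → (Fin n → ℝ))
    (hφ0 : ∀ p, φ 0 p = p)
    (hφ : ∀ t p, HasDerivAt (fun s => φ s p) (X (φ t p)) t)
    (hψ0 : ∀ p, ψ 0 p = p)
    (hψ : ∀ t p, HasDerivAt (fun s => ψ s p) (Y (ψ t p)) t)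
    (hζ0 : ∀ p, ζ 0 p = p)
    (hζ : ∀ t p, HasDerivAt (fun s => ζ s p) (VectorField.lieBracket ℝ X Y (ζ t p)) t)
    (p : Fin n → ℝ) :
    (fun t : ℝ => ψ (-t) (φ (-t) (ψ t (φ t p))) - ζ (t ^ 2) p)
      =o[nhds 0] (fun t : ℝ => t ^ 2) := by
  have hX1 : ∀ x, HasStrictFDerivAt X (fderiv ℝ X x) x := fun x =>
    hX.contDiffAt.hasStrictFDerivAt (by simp)
  have hY1 : ∀ x, HasStrictFDerivAt Y (fderiv ℝ Y x) x := fun x =>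
    hY.contDiffAt.hasStrictFDerivAt (by simp)
  have s0 : (fun t : ℝ => (fun _ : ℝ => p) t - p - t • (0 : Fin n → ℝ) - t ^ 2 • (0 : Fin n → ℝ))
      =o[nhds 0] (fun t : ℝ => t ^ 2) := by
    simp
  have s1 := flowAux_exp X _ p (hX1 p) φ hφ0 hφ 1 _ _ _ s0
  have s2 := flowAux_exp Y _ p (hY1 p) ψ hψ0 hψ 1 _ _ _ s1
  have s3 := flowAux_exp X _ p (hX1 p) φ hφ0 hφ (-1) _ _ _ s2
  have s4 := flowAux_exp Y _ p (hY1 p) ψ hψ0 hψ (-1) _ _ _ s3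
  have z0 := (hasDerivAt_iff_isLittleO.1 (hζ 0 p)).comp_tendsto
    (k := fun t : ℝ => t ^ 2) (l' := nhds 0) (by
      simpa using (continuous_pow 2).tendsto (0 : ℝ))
  have z1 : (fun t : ℝ => ζ (t ^ 2) p - p - t ^ 2 • VectorField.lieBracket ℝ X Y p)
      =o[nhds 0] (fun t : ℝ => t ^ 2) := by
    simpa [Function.comp_def, hζ0] using z0
  refine (s4.sub z1).congr_left fun t => ?_
  simp only [VectorField.lieBracket, map_add, map_smul, map_zero, one_mul, neg_mul]
  module
end

section
/- Let X, Y : ℝ^n → ℝ^n be smooth (C^∞) vector fields admitting global flows φ and ψ respectively, let Z = [X,Y], and suppose Z admits a global flow ζ. If in addition [X,Z] = 0 and [Y,Z] = 0 identically, then the commutator of flows equals the flow of Z exactly: for all t ∈ ℝ and all p ∈ ℝ^n, ψ(-t, φ(-t, ψ(t, φ(t, p)))) = ζ(t², p). -/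
open Set Filter Topology in
lemma fc_lip {E F : Type*} [NormedAddCommGroup E] [NormedSpace ℝ E] [ProperSpace E]
    [NormedAddCommGroup F] [NormedSpace ℝ F]
    (X : E → F) (hX : ContDiff ℝ 1 X) (R : ℝ) :
    ∃ K : NNReal, 1 ≤ K ∧ LipschitzOnWith K X (Metric.closedBall 0 R) := by
  have hc : Continuous (fderiv ℝ X) := hX.continuous_fderiv (by norm_num)
  obtain ⟨C, hC⟩ := (isCompact_closedBall (0 : E) R).exists_bound_of_continuousOn hc.continuousOn
  refine ⟨1 + C.toNNReal, le_self_add, ?_⟩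
  refine Convex.lipschitzOnWith_of_nnnorm_fderiv_le (𝕜 := ℝ)
    (fun x _ => (hX.differentiable (by norm_num)) x) ?_ (convex_closedBall _ _)
  intro x hx
  have h1 := hC x hx
  rw [← NNReal.coe_le_coe]
  have := Real.le_coe_toNNReal C
  push_cast
  have h2 : (↑‖fderiv ℝ X x‖₊ : ℝ) = ‖fderiv ℝ X x‖ := rfl
  linarith

open Set Filter Topology in
lemma fc_tube {E : Type*} [NormedAddCommGroup E] [NormedSpace ℝ E]
    (X : E → E) (U : Set E) (K : NNReal) (hK : 1 ≤ K) (hL : LipschitzOnWith K X U)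
    (u v v' : ℝ → E) (M δ ε : ℝ) (hδ : 0 ≤ δ) (hε : 0 ≤ ε)
    (hu : ∀ s, HasDerivAt u (X (u s)) s)
    (hv : ∀ s, HasDerivAt v (v' s) s)
    (hvX : ∀ s ∈ Icc 0 M, dist (v' s) (X (v s)) ≤ ε)
    (hvU : ∀ s ∈ Icc 0 M, Metric.closedBall (v s) 1 ⊆ U)
    (h0 : dist (u 0) (v 0) ≤ δ)
    (hsmall : (δ + ε) * Real.exp (K * M) < 1) :
    ∀ s ∈ Icc 0 M, dist (u s) (v s) ≤ (δ + ε) * Real.exp (K * M) := by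
  have hK' : (1:ℝ) ≤ K := by exact_mod_cast hK
  have huc : Continuous u := continuous_iff_continuousAt.2 fun s => (hu s).continuousAt
  have hvc : Continuous v := continuous_iff_continuousAt.2 fun s => (hv s).continuousAt
  have key : ∀ b ∈ Icc 0 M, (∀ s ∈ Ico 0 b, dist (u s) (v s) ≤ 1) →
      ∀ s ∈ Icc 0 b, dist (u s) (v s) ≤ (δ + ε) * Real.exp (K * M) := by
    intro b hb hle s hs
    have hsub : ∀ s ∈ Ico 0 b, s ∈ Icc 0 M := fun s hs => ⟨hs.1, hs.2.le.trans hb.2⟩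
    have h := dist_le_of_approx_trajectories_ODE_of_mem (v := fun _ => X) (s := fun _ => U)
      (K := K) (f := u) (g := v) (f' := fun s => X (u s)) (g' := v') (a := 0) (b := b)
      (εf := 0) (εg := ε) (δ := δ)
      (fun _ _ => hL) huc.continuousOn (fun s _ => (hu s).hasDerivWithinAt)
      (fun s _ => by simp) (fun s hs => hvU s (hsub s hs) (hle s hs))
      hvc.continuousOn (fun s _ => (hv s).hasDerivWithinAt)
      (fun s hs => hvX s (hsub s hs))
      (fun s hs => hvU s (hsub s hs) (Metric.mem_closedBall_self zero_le_one)) h0 s hs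
    refine h.trans ?_
    rw [gronwallBound_of_K_ne_0 (by positivity)]
    simp only [zero_add, sub_zero]
    have e1 : Real.exp (K * s) ≤ Real.exp (K * M) := by
      apply Real.exp_le_exp.2
      have : s ≤ M := hs.2.trans hb.2
      gcongr
    have e2 : ε / K ≤ ε := div_le_self hε hK'
    have e3 : 0 ≤ Real.exp (K * s) - 1 := by
      have := hs.1
      have := Real.one_le_exp (x := K * s) (by positivity)
      linarith
    have e4 : δ * Real.exp (K * s) ≤ δ * Real.exp (K * M) := by gcongr
    have e5 : ε / K * (Real.exp (K * s) - 1) ≤ ε * (Real.exp (K * s) - 1) := by gcongr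
    have e6 : ε * Real.exp (K * s) ≤ ε * Real.exp (K * M) := by gcongr
    linarith
  have hall : ∀ s ∈ Icc 0 M, dist (u s) (v s) < 1 := by
    by_contra! hcon
    obtain ⟨s0, hs0, hd⟩ := hcon
    have hcomp : IsCompact (Icc 0 M ∩ {s | 1 ≤ dist (u s) (v s)}) :=
      isCompact_Icc.inter_right (isClosed_le continuous_const (huc.dist hvc))
    obtain ⟨s1, ⟨hs1, hd1⟩, hmin⟩ := hcomp.exists_isLeast ⟨s0, hs0, hd⟩
    have := key s1 hs1 (fun s hs => by
      by_contra! hc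
      exact absurd (hmin ⟨⟨hs.1, hs.2.le.trans hs1.2⟩, hc.le⟩) (not_le.2 hs.2)) s1 ⟨hs1.1, le_rfl⟩
    have hd1' : 1 ≤ dist (u s1) (v s1) := hd1
    linarith
  intro s hs
  have h0M : (0:ℝ) ≤ M := hs.1.trans hs.2
  exact key M ⟨h0M, le_rfl⟩ (fun s hs => (hall s ⟨hs.1, hs.2.le⟩).le) s hs

open Set Filter Topology in
lemma fc_unique {E : Type*} [NormedAddCommGroup E] [NormedSpace ℝ E] [ProperSpace E]
    (X : E → E) (hX : ContDiff ℝ 1 X) (f g : ℝ → E)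
    (hf : ∀ t, HasDerivAt f (X (f t)) t) (hg : ∀ t, HasDerivAt g (X (g t)) t)
    (h0 : f 0 = g 0) (t : ℝ) : f t = g t := by
  have hfc : Continuous f := continuous_iff_continuousAt.2 fun s => (hf s).continuousAt
  have hgc : Continuous g := continuous_iff_continuousAt.2 fun s => (hg s).continuousAt
  obtain ⟨A, hA⟩ := (isCompact_Icc (a := -(|t|+1)) (b := |t|+1)).exists_bound_of_continuousOn
    hfc.continuousOn
  obtain ⟨B, hB⟩ := (isCompact_Icc (a := -(|t|+1)) (b := |t|+1)).exists_bound_of_continuousOn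
    hgc.continuousOn
  obtain ⟨K, -, hK⟩ := fc_lip X hX (max A B)
  refine ODE_solution_unique_of_mem_Ioo (v := fun _ => X) (s := fun _ => Metric.closedBall 0 (max A B))
    (K := K) (a := -(|t|+1)) (b := |t|+1) (t₀ := 0) (fun _ _ => hK) ?_ ?_ ?_ h0 ?_
  · constructor <;> linarith [abs_nonneg t]
  · intro s hs
    exact ⟨hf s, by simpa using Or.inl (hA s ⟨hs.1.le, hs.2.le⟩)⟩
  · intro s hs
    exact ⟨hg s, by simpa using Or.inr (hB s ⟨hs.1.le, hs.2.le⟩)⟩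
  · constructor <;> linarith [neg_abs_le t, le_abs_self t]

open Set Filter Topology in
lemma fc_est {E : Type*} [NormedAddCommGroup E] [NormedSpace ℝ E] [ProperSpace E]
    (X : E → E) (hX : ContDiff ℝ 2 X) (φ : ℝ → E → E)
    (hφ0 : ∀ p, φ 0 p = p)
    (hφ : ∀ t p, HasDerivAt (fun s => φ s p) (X (φ t p)) t)
    (q : E) (w : ℝ → E)
    (hw : ∀ s, HasDerivAt w (fderiv ℝ X (φ s q) (w s)) s) (M : ℝ) :
    ∃ C : ℝ, 0 < C ∧ ∀ (h : ℝ) (x : E), |h| ≤ 1 → (‖x - (q + h • w 0)‖ + h ^ 2) * C < 1 →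
      ∀ s, |s| ≤ M → ‖φ s x - (φ s q + h • w s)‖ ≤ (‖x - (q + h • w 0)‖ + h ^ 2) * C := by
  have hX1 : ContDiff ℝ 1 X := hX.of_le (by norm_num)
  have hφc : Continuous (fun s => φ s q) :=
    continuous_iff_continuousAt.2 fun s => (hφ s q).continuousAt
  have hwc : Continuous w := continuous_iff_continuousAt.2 fun s => (hw s).continuousAt
  obtain ⟨R, hR⟩ := (isCompact_Icc (a := -M) (b := M)).exists_bound_of_continuousOn
    hφc.continuousOn
  obtain ⟨B, hB⟩ := (isCompact_Icc (a := -M) (b := M)).exists_bound_of_continuousOn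
    hwc.continuousOn
  obtain ⟨K, hK1, hK⟩ := fc_lip X hX1 (R + B + 1)
  obtain ⟨L, -, hL⟩ := fc_lip (fderiv ℝ X) (hX.fderiv_right (by norm_num)) (R + B + 1)
  refine ⟨(1 + L * B ^ 2) * Real.exp (K * M), by positivity, ?_⟩
  intro h x hh hsm s hs
  set δ := ‖x - (q + h • w 0)‖ with hδ
  have hδ0 : 0 ≤ δ := norm_nonneg _
  have hle : (δ + L * B ^ 2 * h ^ 2) * Real.exp (K * M) ≤
      (δ + h ^ 2) * ((1 + L * B ^ 2) * Real.exp (K * M)) := by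
    rw [← mul_assoc]
    gcongr
    have : 0 ≤ δ * (L * B ^ 2) := by positivity
    nlinarith [sq_nonneg h]
  refine le_trans ?_ hle
  have hsm' := lt_of_le_of_lt hle hsm
  let v : ℝ → E := fun s => φ s q + h • w s
  let v' : ℝ → E := fun s => X (φ s q) + h • fderiv ℝ X (φ s q) (w s)
  have hv : ∀ s, HasDerivAt v (v' s) s := fun s => (hφ s q).add ((hw s).const_smul h)
  have hhw : ∀ s ∈ Icc (-M) M, ‖h • w s‖ ≤ |h| * B := by
    intro s hs
    rw [norm_smul, Real.norm_eq_abs]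
    gcongr
    exact hB s hs
  have hvU : ∀ s ∈ Icc (-M) M, Metric.closedBall (v s) 1 ⊆ Metric.closedBall 0 (R + B + 1) := by
    intro s hs y hy
    have h1 := hhw s hs
    have h2 := hR s hs
    have hB0 : 0 ≤ B := (norm_nonneg _).trans (hB s hs)
    have h3 : |h| * B ≤ B := by nlinarith
    rw [mem_closedBall_iff_norm] at hy
    rw [mem_closedBall_zero_iff]
    have h4 : ‖v s‖ ≤ ‖φ s q‖ + ‖h • w s‖ := norm_add_le _ _
    have h5 : ‖y‖ ≤ ‖y - v s‖ + ‖v s‖ := by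
      simpa using norm_add_le (y - v s) (v s)
    linarith
  have hvX : ∀ s ∈ Icc (-M) M, dist (v' s) (X (v s)) ≤ L * B ^ 2 * h ^ 2 := by
    intro s hs
    have h1 := hhw s hs
    have h2 := hR s hs
    have hB0 : 0 ≤ B := (norm_nonneg _).trans (hB s hs)
    have hxU : φ s q ∈ Metric.closedBall (0:E) (R + B + 1) := by
      rw [mem_closedBall_zero_iff]; linarith
    have hyU : v s ∈ Metric.closedBall (0:E) (R + B + 1) :=
      hvU s hs (Metric.mem_closedBall_self zero_le_one)
    have hseg : segment ℝ (φ s q) (v s) ⊆ Metric.closedBall (0:E) (R + B + 1) :=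
      (convex_closedBall _ _).segment_subset hxU hyU
    have hT := Convex.norm_image_sub_le_of_norm_fderiv_le' (𝕜 := ℝ) (f := X)
      (φ := fderiv ℝ X (φ s q)) (C := L * ‖v s - φ s q‖) (s := segment ℝ (φ s q) (v s))
      (fun x _ => hX1.differentiable (by norm_num) x)
      (fun z hz => by
        have := hL.dist_le_mul z (hseg hz) _ hxU
        rw [dist_eq_norm, dist_eq_norm] at this
        refine this.trans ?_
        gcongr
        exact norm_sub_le_of_mem_segment hz)
      (convex_segment _ _) (left_mem_segment _ _ _) (right_mem_segment _ _ _)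
    have hvs : v s - φ s q = h • w s := by simp [v]
    rw [hvs] at hT
    rw [dist_comm, dist_eq_norm]
    have : X (v s) - v' s = X (v s) - X (φ s q) - fderiv ℝ X (φ s q) (h • w s) := by
      simp only [v', map_smul]; abel
    rw [this]
    refine hT.trans ?_
    calc L * ‖h • w s‖ * ‖h • w s‖ ≤ L * (|h| * B) * (|h| * B) := by gcongr
      _ = L * B ^ 2 * |h| ^ 2 := by ring
      _ = _ := by rw [sq_abs]
  have hd0 : dist (φ 0 x) (v 0) ≤ δ := by
    simp [v, hφ0, dist_eq_norm, hδ]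
  rw [← dist_eq_norm]
  rw [abs_le] at hs
  rcases le_total 0 s with h0 | h0
  · have hM : 0 ≤ M := h0.trans hs.2
    exact fc_tube X _ K hK1 hK (fun s => φ s x) v v' M δ (L * B ^ 2 * h ^ 2) hδ0 (by positivity)
      (fun s => hφ s x) hv (fun s hs => hvX s ⟨by linarith [hs.1], hs.2⟩)
      (fun s hs => hvU s ⟨by linarith [hs.1], hs.2⟩) hd0 hsm' s ⟨h0, hs.2⟩
  · have hM : 0 ≤ M := by linarith
    have := fc_tube (fun x => - X x) _ K hK1 hK.neg (fun s => φ (-s) x) (fun s => v (-s))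
      (fun s => - v' (-s)) M δ (L * B ^ 2 * h ^ 2) hδ0 (by positivity)
      (fun s => ((hφ (-s) x).scomp s (hasDerivAt_neg s)).congr_deriv (by simp))
      (fun s => ((hv (-s)).scomp s (hasDerivAt_neg s)).congr_deriv (by simp))
      (fun s hs => by
        rw [dist_neg_neg]
        exact hvX (-s) ⟨by linarith [hs.2], by linarith [hs.1]⟩)
      (fun s hs => hvU (-s) ⟨by linarith [hs.2], by linarith [hs.1]⟩) (by simpa using hd0) hsm'
      (-s) ⟨by linarith, by linarith⟩
    simpa using this

open Set Filter Topology Asymptotics in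
lemma fc_deriv {E : Type*} [NormedAddCommGroup E] [NormedSpace ℝ E] [ProperSpace E]
    (X : E → E) (hX : ContDiff ℝ 2 X) (φ : ℝ → E → E)
    (hφ0 : ∀ p, φ 0 p = p)
    (hφ : ∀ t p, HasDerivAt (fun s => φ s p) (X (φ t p)) t)
    (c : ℝ → E) (t : ℝ) (w : ℝ → E)
    (hw : ∀ s, HasDerivAt w (fderiv ℝ X (φ s (c t)) (w s)) s)
    (hc : HasDerivAt c (w 0) t) (τ : ℝ → ℝ) (τ' : ℝ) (hτ : HasDerivAt τ τ' t) :
    HasDerivAt (fun r => φ (τ r) (c r)) (τ' • X (φ (τ t) (c t)) + w (τ t)) t := by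
  obtain ⟨C, hC, hest⟩ := fc_est X hX φ hφ0 hφ (c t) w hw (|τ t| + 1)
  -- main part
  have hmain : HasDerivAt (fun r => φ (τ r) (c t) + (r - t) • w (τ r))
      (τ' • X (φ (τ t) (c t)) + w (τ t)) t := by
    have h1 : HasDerivAt (fun r => φ (τ r) (c t)) (τ' • X (φ (τ t) (c t))) t :=
      (hφ (τ t) (c t)).scomp t hτ
    have h2 : HasDerivAt (fun r => w (τ r)) (τ' • fderiv ℝ X (φ (τ t) (c t)) (w (τ t))) t :=
      (hw (τ t)).scomp t hτ
    have h3 := ((hasDerivAt_id t).sub_const t).smul h2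
    exact (h1.add h3).congr_deriv (by simp)
  -- error part
  have ho : (fun r => ‖c r - (c t + (r - t) • w 0)‖ + (r - t) ^ 2) =o[𝓝 t] fun r => r - t := by
    refine IsLittleO.add ?_ ?_
    · have := (hasDerivAt_iff_isLittleO.1 hc).norm_left
      refine this.congr_left fun r => ?_
      congr 1; abel
    · have h1 : Tendsto (fun r : ℝ => r - t) (𝓝 t) (𝓝 0) := by
        have : Continuous fun r : ℝ => r - t := by fun_prop
        simpa using this.tendsto t
      have := (isLittleO_one_iff ℝ).2 h1
      have := this.mul_isBigO (isBigO_refl (fun r : ℝ => r - t) (𝓝 t))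
      simpa [pow_two] using this
  have ho2 : (fun r => (‖c r - (c t + (r - t) • w 0)‖ + (r - t) ^ 2) * C) =o[𝓝 t]
      fun r => r - t := by
    simpa [mul_comm] using ho.const_mul_left C
  have htend : Tendsto (fun r : ℝ => r - t) (𝓝 t) (𝓝 0) := by
    have : Continuous fun r : ℝ => r - t := by fun_prop
    simpa using this.tendsto t
  have ev1 : ∀ᶠ r in 𝓝 t, |r - t| ≤ 1 := by
    have := htend.abs
    rw [abs_zero] at this
    exact (this.eventually (gt_mem_nhds zero_lt_one)).mono fun _ h => h.le
  have ev2 : ∀ᶠ r in 𝓝 t, (‖c r - (c t + (r - t) • w 0)‖ + (r - t) ^ 2) * C < 1 :=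
    (ho2.trans_tendsto htend).eventually (gt_mem_nhds zero_lt_one)
  have ev3 : ∀ᶠ r in 𝓝 t, |τ r| ≤ |τ t| + 1 := by
    have := hτ.continuousAt.abs
    exact (this.eventually (gt_mem_nhds (lt_add_one _))).mono fun _ h => h.le
  have hErr : (fun r => φ (τ r) (c r) - (φ (τ r) (c t) + (r - t) • w (τ r))) =o[𝓝 t]
      fun r => r - t := by
    refine IsBigO.trans_isLittleO (IsBigO.of_bound 1 ?_) ho2
    filter_upwards [ev1, ev2, ev3] with r h1 h2 h3
    rw [one_mul]
    exact (hest (r - t) (c r) h1 h2 (τ r) h3).trans (le_abs_self _)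
  rw [hasDerivAt_iff_isLittleO] at hmain ⊢
  refine (hErr.add hmain).congr_left fun r => ?_
  simp only [sub_self, zero_smul, add_zero]
  abel

/-- If `X, Y` are smooth vector fields on `ℝⁿ` with global flows `φ, ψ`, the bracket
`Z = [X,Y]` has global flow `ζ`, and `[X,Z] = 0`, `[Y,Z] = 0` identically, then the
commutator of flows equals the flow of `Z` exactly:
`ψ(-t, φ(-t, ψ(t, φ(t, p)))) = ζ(t², p)` for all `t` and `p`. -/
theorem flow_commutator_eq_of_brackets_vanish {n : ℕ}
    (X Y : (Fin n → ℝ) → (Fin n → ℝ))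
    (hX : ContDiff ℝ (⊤ : ℕ∞) X) (hY : ContDiff ℝ (⊤ : ℕ∞) Y)
    (φ ψ ζ : ℝ → (Fin n → ℝ) → (Fin n → ℝ))
    (hφ0 : ∀ p, φ 0 p = p)
    (hφ : ∀ t p, HasDerivAt (fun s => φ s p) (X (φ t p)) t)
    (hψ0 : ∀ p, ψ 0 p = p)
    (hψ : ∀ t p, HasDerivAt (fun s => ψ s p) (Y (ψ t p)) t)
    (hζ0 : ∀ p, ζ 0 p = p)
    (hζ : ∀ t p, HasDerivAt (fun s => ζ s p) (VectorField.lieBracket ℝ X Y (ζ t p)) t)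
    (hXZ : VectorField.lieBracket ℝ X (VectorField.lieBracket ℝ X Y) = 0)
    (hYZ : VectorField.lieBracket ℝ Y (VectorField.lieBracket ℝ X Y) = 0) :
    ∀ (t : ℝ) (p : Fin n → ℝ), ψ (-t) (φ (-t) (ψ t (φ t p))) = ζ (t ^ 2) p := by
  have hX2 : ContDiff ℝ 2 X := hX.of_le (by exact WithTop.coe_le_coe.2 (le_top (a := (2 : ℕ∞))))
  have hY2 : ContDiff ℝ 2 Y := hY.of_le (by exact WithTop.coe_le_coe.2 (le_top (a := (2 : ℕ∞))))
  have hZ1 : ContDiff ℝ 1 (VectorField.lieBracket ℝ X Y) :=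
    hX2.lieBracket_vectorField hY2 (by norm_num)
  have hXZ' : ∀ x, fderiv ℝ (VectorField.lieBracket ℝ X Y) x (X x) =
      fderiv ℝ X x (VectorField.lieBracket ℝ X Y x) := fun x => sub_eq_zero.1 (congrFun hXZ x)
  have hYZ' : ∀ x, fderiv ℝ (VectorField.lieBracket ℝ X Y) x (Y x) =
      fderiv ℝ Y x (VectorField.lieBracket ℝ X Y x) := fun x => sub_eq_zero.1 (congrFun hYZ x)
  have hZe : ∀ x, VectorField.lieBracket ℝ X Y x = fderiv ℝ Y x (X x) - fderiv ℝ X x (Y x) :=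
    fun x => rfl
  generalize VectorField.lieBracket ℝ X Y = Z at *
  have hX1 : ContDiff ℝ 1 X := hX2.of_le (by norm_num)
  have hXd : Differentiable ℝ X := hX1.differentiable (by norm_num)
  have hZd : Differentiable ℝ Z := hZ1.differentiable (by norm_num)
  -- transport of `Z` along `X`
  have wXZ : ∀ q s, HasDerivAt (fun s => Z (φ s q)) (fderiv ℝ X (φ s q) (Z (φ s q))) s := by
    intro q s
    rw [← hXZ']
    exact (hZd (φ s q)).hasFDerivAt.comp_hasDerivAt s (hφ s q)
  have wYZ : ∀ q s, HasDerivAt (fun s => Z (ψ s q)) (fderiv ℝ Y (ψ s q) (Z (ψ s q))) s := by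
    intro q s
    rw [← hYZ']
    exact (hZd (ψ s q)).hasFDerivAt.comp_hasDerivAt s (hψ s q)
  have wYX : ∀ q s, HasDerivAt (fun s => X (ψ s q) + s • Z (ψ s q))
      (fderiv ℝ Y (ψ s q) (X (ψ s q) + s • Z (ψ s q))) s := by
    intro q s
    have h1 : HasDerivAt (fun s => X (ψ s q)) (fderiv ℝ X (ψ s q) (Y (ψ s q))) s :=
      (hXd (ψ s q)).hasFDerivAt.comp_hasDerivAt s (hψ s q)
    have h2 := h1.add ((hasDerivAt_id s).smul (wYZ q s))
    refine h2.congr_deriv ?_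
    have := hZe (ψ s q)
    rw [map_add, map_smul]
    simp only [id, one_smul]
    rw [this]
    abel
  have inv : ∀ (V : (Fin n → ℝ) → (Fin n → ℝ)) (θ : ℝ → (Fin n → ℝ) → (Fin n → ℝ)),
      ContDiff ℝ 1 V → (∀ p, θ 0 p = p) → (∀ t p, HasDerivAt (fun s => θ s p) (V (θ t p)) t) →
      ∀ t p, θ (-t) (θ t p) = p := by
    intro V θ hV h0 h t p
    have := fc_unique V hV (fun s => θ s (θ t p)) (fun s => θ (s + t) p) (fun s => h s _)
      (fun s => (h (s + t) p).comp_add_const s t) (by simp [h0]) (-t)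
    simpa [h0] using this
  -- the flows of `X` and `Z` commute
  have comm : ∀ t s p, φ (-t) (ζ s (φ t p)) = ζ s p := by
    intro t s p
    refine fc_unique Z hZ1 (fun s => φ (-t) (ζ s (φ t p))) (fun s => ζ s p) ?_
      (fun s => hζ s p) ?_ s
    · intro s
      have := fc_deriv X hX2 φ hφ0 hφ (fun s => ζ s (φ t p)) s (fun r => Z (φ r (ζ s (φ t p))))
        (fun r => wXZ _ r) (by simpa [hφ0] using hζ s (φ t p)) (fun _ => -t) 0
        (hasDerivAt_const _ _)
      simpa using this
    · simp [hζ0, inv X φ hX1 hφ0 hφ]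
  have main : ∀ t s q, ψ (-t) (φ s (ψ t q)) = φ s (ζ (-t * s) q) := by
    intro t s q
    refine fc_unique (fun x => X x + (-t) • Z x) (hX1.add (hZ1.const_smul (-t)))
      (fun s => ψ (-t) (φ s (ψ t q))) (fun s => φ s (ζ (-t * s) q)) ?_ ?_ ?_ s
    · intro s
      have := fc_deriv Y hY2 ψ hψ0 hψ (fun s => φ s (ψ t q)) s
        (fun r => X (ψ r (φ s (ψ t q))) + r • Z (ψ r (φ s (ψ t q))))
        (fun r => wYX _ r) (by simpa [hψ0] using hφ s (ψ t q)) (fun _ => -t) 0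
        (hasDerivAt_const _ _)
      simpa using this
    · intro s
      have hlin : HasDerivAt (fun s : ℝ => -t * s) (-t) s := by
        simpa using (hasDerivAt_id s).const_mul (-t)
      have := fc_deriv X hX2 φ hφ0 hφ (fun s => ζ (-t * s) q) s
        (fun r => (-t) • Z (φ r (ζ (-t * s) q)))
        (fun r => by
          rw [map_smul]
          exact (wXZ (ζ (-t * s) q) r).const_smul (-t))
        (by
          have := (hζ (-t * s) q).scomp s hlin
          exact this.congr_deriv (by simp only [hφ0])) (fun r => r) 1 (hasDerivAt_id s)
      simpa using this
    · simp [hφ0, hζ0, inv Y ψ (hY2.of_le (by norm_num)) hψ0 hψ]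
  intro t p
  rw [main, comm]
  congr 1
  ring
end

section
/- (Chow–Rashevskii) Let X₁, …, X_m : ℝ^n → ℝ^n be smooth (C^∞) vector fields, each admitting a global flow φ₁, …, φ_m. Let B be the smallest set of vector fields containing X₁, …, X_m and closed under the Lie bracket (i.e., the set of all iterated Lie brackets of the X_i). Assume the distribution is bracket generating: for every p ∈ ℝ^n, the linear span of { V(p) : V ∈ B } is all of ℝ^n. Then any two points of ℝ^n can be joined by a concatenation of integral-curve arcs of the X_i: for all p, q ∈ ℝ^n there exist k ∈ ℕ, indices i₁, …, i_k ∈ {1,…,m}, and times t₁, …, t_k ∈ ℝ such that φ_{i_k}(t_k, · ) ∘ ⋯ ∘ φ_{i₁}(t₁, · ) applied to p equals q. -/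
/-- The set of iterated Lie brackets of a family of vector fields `X i` on `ℝⁿ`:
each `X i` belongs to it, and it is closed under the Lie bracket. -/
inductive IsIteratedBracket {n : ℕ} {ι : Type*} (X : ι → (Fin n → ℝ) → (Fin n → ℝ)) :
    ((Fin n → ℝ) → (Fin n → ℝ)) → Prop
  | base (i : ι) : IsIteratedBracket X (X i)
  | bracket {V W : (Fin n → ℝ) → (Fin n → ℝ)} :
      IsIteratedBracket X V → IsIteratedBracket X W →
      IsIteratedBracket X (VectorField.lieBracket ℝ V W)

/-- The result of successively applying the flows `φ (i 0) (t 0)`, `φ (i 1) (t 1)`, …,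
`φ (i (k-1)) (t (k-1))` to a point `p`. -/
def steer {n m : ℕ} (φ : Fin m → ℝ → (Fin n → ℝ) → (Fin n → ℝ)) :
    (k : ℕ) → (Fin k → Fin m) → (Fin k → ℝ) → (Fin n → ℝ) → (Fin n → ℝ)
  | 0, _, _, p => p
  | k + 1, i, t, p =>
      φ (i (Fin.last k)) (t (Fin.last k))
        (steer φ k (fun j => i j.castSucc) (fun j => t j.castSucc) p)

open Set Filter Topology Metric
open scoped NNReal ContDiff

theorem gron_fwd {E : Type*} [NormedAddCommGroup E] [NormedSpace ℝ E] {X : E → E} {s : Set E}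
    {K : ℝ≥0} (hX : LipschitzOnWith K X s) {f g g' : ℝ → E} {b η : ℝ} (hη : 0 ≤ η)
    (hf : ∀ t ∈ Ico 0 b, HasDerivAt f (X (f t)) t) (hfs : ∀ t ∈ Ico 0 b, f t ∈ s)
    (hg : ∀ t ∈ Ico 0 b, HasDerivAt g (g' t) t) (hgs : ∀ t ∈ Ico 0 b, g t ∈ s)
    (hgb : ∀ t ∈ Ico 0 b, dist (g' t) (X (g t)) ≤ η) (h0 : f 0 = g 0) :
    ∀ t ∈ Ico 0 b, dist (f t) (g t) ≤ η * Real.exp ((K + 1) * b) := by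
  intro t ht
  have hsub : ∀ τ ∈ Icc 0 t, τ ∈ Ico 0 b := fun τ hτ => ⟨hτ.1, hτ.2.trans_lt ht.2⟩
  have hsub' : ∀ τ ∈ Ico 0 t, τ ∈ Ico 0 b := fun τ hτ => ⟨hτ.1, hτ.2.trans ht.2⟩
  have := dist_le_of_approx_trajectories_ODE_of_mem (v := fun _ => X) (s := fun _ => s) (K := K + 1)
    (f' := fun t => X (f t)) (g' := g') (εf := 0) (εg := η) (δ := 0) (a := 0) (b := t) (f := f) (g := g)
    (fun _ _ => hX.weaken (by simp))
    (fun τ hτ => (hf τ (hsub τ hτ)).continuousAt.continuousWithinAt)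
    (fun τ hτ => (hf τ (hsub' τ hτ)).hasDerivWithinAt)
    (by simp) (fun τ hτ => hfs τ (hsub' τ hτ))
    (fun τ hτ => (hg τ (hsub τ hτ)).continuousAt.continuousWithinAt)
    (fun τ hτ => (hg τ (hsub' τ hτ)).hasDerivWithinAt)
    (fun τ hτ => hgb τ (hsub' τ hτ)) (fun τ hτ => hgs τ (hsub' τ hτ)) (by simp [h0]) t ⟨ht.1, le_rfl⟩
  refine this.trans ?_
  have hK : ((K + 1 : ℝ≥0) : ℝ) ≠ 0 := by positivity
  rw [gronwallBound_of_K_ne_0 hK]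
  simp only [zero_mul, zero_add, sub_zero, NNReal.coe_add, NNReal.coe_one]
  have h1 : η / ((K : ℝ) + 1) ≤ η := div_le_self hη (by simp)
  have h2 : Real.exp (((K : ℝ) + 1) * t) - 1 ≤ Real.exp (((K : ℝ) + 1) * b) := by
    have : Real.exp (((K : ℝ) + 1) * t) ≤ Real.exp (((K : ℝ) + 1) * b) := by
      apply Real.exp_le_exp.2
      have := ht.2.le
      gcongr
    linarith
  have h3 : 0 ≤ Real.exp (((K : ℝ) + 1) * t) - 1 := by
    have : 0 ≤ ((K : ℝ) + 1) * t := mul_nonneg (by positivity) ht.1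
    linarith [Real.one_le_exp this]
  exact mul_le_mul h1 h2 h3 hη

theorem gron_two {E : Type*} [NormedAddCommGroup E] [NormedSpace ℝ E] {X : E → E} {s : Set E}
    {K : ℝ≥0} (hX : LipschitzOnWith K X s) {f g g' : ℝ → E} {b η : ℝ} (hη : 0 ≤ η)
    (hf : ∀ t ∈ Ioo (-b) b, HasDerivAt f (X (f t)) t) (hfs : ∀ t ∈ Ioo (-b) b, f t ∈ s)
    (hg : ∀ t ∈ Ioo (-b) b, HasDerivAt g (g' t) t) (hgs : ∀ t ∈ Ioo (-b) b, g t ∈ s)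
    (hgb : ∀ t ∈ Ioo (-b) b, dist (g' t) (X (g t)) ≤ η) (h0 : f 0 = g 0) :
    ∀ t ∈ Ioo (-b) b, dist (f t) (g t) ≤ η * Real.exp ((K + 1) * b) := by
  intro t ht
  rcases le_total 0 t with h | h
  · have hs : ∀ τ ∈ Ico 0 b, τ ∈ Ioo (-b) b := fun τ hτ => ⟨by linarith [hτ.1, hτ.2], hτ.2⟩
    exact gron_fwd hX hη (fun τ hτ => hf τ (hs τ hτ)) (fun τ hτ => hfs τ (hs τ hτ))
      (fun τ hτ => hg τ (hs τ hτ)) (fun τ hτ => hgs τ (hs τ hτ)) (fun τ hτ => hgb τ (hs τ hτ)) h0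
      t ⟨h, ht.2⟩
  · have hs : ∀ τ ∈ Ico 0 b, -τ ∈ Ioo (-b) b := fun τ hτ => ⟨by linarith [hτ.1, hτ.2], by linarith [hτ.1, hτ.2]⟩
    have hX' : LipschitzOnWith K (fun x => - X x) s := by
      intro x hx y hy
      simpa [edist_neg_neg] using hX hx hy
    have := gron_fwd (f := fun τ => f (-τ)) (g := fun τ => g (-τ)) (g' := fun τ => - g' (-τ)) (b := b)
      hX' hη (fun τ hτ => by
        simpa [Function.comp_def] using (hf (-τ) (hs τ hτ)).scomp τ (hasDerivAt_neg τ)) (fun τ hτ => hfs _ (hs τ hτ))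
      (fun τ hτ => by
        simpa [Function.comp_def] using (hg (-τ) (hs τ hτ)).scomp τ (hasDerivAt_neg τ)) (fun τ hτ => hgs _ (hs τ hτ))
      (fun τ hτ => by simpa [dist_neg_neg] using hgb _ (hs τ hτ)) (by simpa using h0)
      (-t) ⟨by linarith, by linarith [ht.1]⟩
    simpa using this

theorem quad_bound {E : Type*} [NormedAddCommGroup E] [NormedSpace ℝ E] {X : E → E} {s : Set E}
    (hs : Convex ℝ s) (hd : Differentiable ℝ X)
    {K : ℝ≥0} (hX : LipschitzOnWith K (fderiv ℝ X) s) {y v : E} (hy : y ∈ s) (hv : y + v ∈ s) :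
    ‖X y + fderiv ℝ X y v - X (y + v)‖ ≤ K * ‖v‖ ^ 2 := by
  have hseg : segment ℝ y (y + v) ⊆ s := hs.segment_subset hy hv
  have := (convex_segment (𝕜 := ℝ) y (y + v)).norm_image_sub_le_of_norm_fderiv_le'
    (f := X) (φ := fderiv ℝ X y) (C := K * ‖v‖) (x := y) (y := y + v) (fun x _ => hd x)
    (fun x hx => by
      refine (hX.norm_sub_le (hseg hx) hy).trans ?_
      gcongr
      have := norm_sub_le_of_mem_segment hx
      simpa using this) (left_mem_segment _ _ _) (right_mem_segment _ _ _)
  rw [← norm_neg]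
  have e : -(X y + fderiv ℝ X y v - X (y + v)) = X (y + v) - X y - fderiv ℝ X y (y + v - y) := by
    rw [add_sub_cancel_left]; abel
  rw [e]
  refine this.trans (le_of_eq ?_)
  rw [add_sub_cancel_left]; ring

theorem flow_diff {E : Type*} [NormedAddCommGroup E] [NormedSpace ℝ E] {X : E → E}
    (hX : ContDiff ℝ ∞ X) {p : E} {r ε : ℝ} (hr : 0 < r) (hε : 0 < ε)
    {ψ : E × ℝ → E} {A : E × ℝ → E →L[ℝ] E}
    (hψ0 : ∀ x ∈ ball p r, ψ (x, 0) = x)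
    (hA0 : ∀ x ∈ ball p r, A (x, 0) = ContinuousLinearMap.id ℝ E)
    (hψ : ∀ x ∈ ball p r, ∀ t ∈ Ioo (-ε) ε, HasDerivAt (fun t => ψ (x, t)) (X (ψ (x, t))) t)
    (hA : ∀ x ∈ ball p r, ∀ t ∈ Ioo (-ε) ε,
      HasDerivAt (fun t => A (x, t)) ((fderiv ℝ X (ψ (x, t))).comp (A (x, t))) t)
    (hψc : ContinuousAt ψ (p, 0)) (hAc : ContinuousAt A (p, 0)) :
    ∃ u ∈ 𝓝 (p, (0 : ℝ)), ∀ z ∈ u, HasFDerivAt ψ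
      ((A z).coprod (ContinuousLinearMap.toSpanSingleton ℝ (X (ψ z)))) z := by
  have hp : p ∈ ball p r := mem_ball_self hr
  obtain ⟨K1, s1, hs1, hL1⟩ := (hX.of_le (m := 1) (by exact_mod_cast le_top)).contDiffAt (x := p).exists_lipschitzOnWith
  obtain ⟨K2, s2, hs2, hL2⟩ := (((hX.fderiv_right (m := ∞) (by simp)).of_le (m := 1) (by exact_mod_cast le_top)).contDiffAt (x := p)).exists_lipschitzOnWith
  obtain ⟨R, hR, hRs⟩ := Metric.mem_nhds_iff.1 (inter_mem hs1 hs2)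
  have hL1 := hL1.mono (hRs.trans inter_subset_left)
  have hL2 := hL2.mono (hRs.trans inter_subset_right)
  have ev1 : ∀ᶠ z in 𝓝 (p, (0 : ℝ)), ψ z ∈ ball p (R / 2) := by
    apply hψc
    rw [hψ0 p hp]; exact ball_mem_nhds _ (by positivity)
  have ev2 : ∀ᶠ z in 𝓝 (p, (0 : ℝ)), ‖A z‖ < 2 := by
    have : ‖A (p, 0)‖ < 2 := by
      rw [hA0 p hp]
      exact ContinuousLinearMap.norm_id_le.trans_lt (by norm_num)
    exact hAc.norm.eventually_lt_const this
  obtain ⟨δ, hδ, hδs⟩ := Metric.mem_nhds_iff.1 (ev1.and ev2)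
  set d := min δ (min r ε) with hd
  have hd0 : 0 < d := by positivity
  have hdr : d ≤ r := (min_le_right _ _).trans (min_le_left _ _)
  have hdε : d ≤ ε := (min_le_right _ _).trans (min_le_right _ _)
  have hbr : ∀ x ∈ ball p d, x ∈ ball p r := fun x hx => ball_subset_ball hdr hx
  have hbt : ∀ t ∈ Ioo (-d) d, t ∈ Ioo (-ε) ε := fun t ht =>
    ⟨by linarith [ht.1], by linarith [ht.2]⟩
  have hz : ∀ x ∈ ball p d, ∀ t ∈ Ioo (-d) d, ψ (x, t) ∈ ball p (R/2) ∧ ‖A (x, t)‖ < 2 := by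
    intro x hx t ht
    apply hδs
    rw [mem_ball, Prod.dist_eq, max_lt_iff]
    refine ⟨lt_of_lt_of_le hx (min_le_left _ _), ?_⟩
    rw [Real.dist_eq, sub_zero]
    exact lt_of_lt_of_le (abs_lt.2 ht) (min_le_left _ _)
  have key : ∀ x0 ∈ ball p d, ∀ x ∈ ball p d, ‖x - x0‖ < R / 4 → ∀ t ∈ Ioo (-d) d,
      ‖ψ (x, t) - ψ (x0, t) - A (x0, t) (x - x0)‖ ≤
        (K2 * 4 * Real.exp ((K1 + 1) * d)) * ‖x - x0‖ ^ 2 := by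
    intro x0 hx0 x hx hxx t ht
    have hAh : ∀ τ ∈ Ioo (-d) d, ‖A (x0, τ) (x - x0)‖ ≤ 2 * ‖x - x0‖ := fun τ hτ =>
      (A (x0, τ)).le_of_opNorm_le (hz x0 hx0 τ hτ).2.le _
    have hgs : ∀ τ ∈ Ioo (-d) d, ψ (x0, τ) + A (x0, τ) (x - x0) ∈ ball p R := by
      intro τ hτ
      have h1 := (hz x0 hx0 τ hτ).1
      have h2 := hAh τ hτ
      rw [mem_ball, dist_eq_norm] at h1 ⊢
      have : ψ (x0, τ) + A (x0, τ) (x - x0) - p = (ψ (x0, τ) - p) + A (x0, τ) (x - x0) := by abel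
      rw [this]
      refine (norm_add_le _ _).trans_lt (by linarith)
    have hhalf : ball p (R/2) ⊆ ball p R := ball_subset_ball (by linarith)
    have := gron_two (X := X) (s := ball p R) hL1 (f := fun τ => ψ (x, τ))
      (g := fun τ => ψ (x0, τ) + A (x0, τ) (x - x0))
      (g' := fun τ => X (ψ (x0, τ)) + fderiv ℝ X (ψ (x0, τ)) (A (x0, τ) (x - x0)))
      (b := d) (η := K2 * 4 * ‖x - x0‖ ^ 2) (by positivity)
      (fun τ hτ => hψ x (hbr x hx) τ (hbt τ hτ)) (fun τ hτ => hhalf (hz x hx τ hτ).1)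
      (fun τ hτ => (hψ x0 (hbr x0 hx0) τ (hbt τ hτ)).add (by
        simpa using (hA x0 (hbr x0 hx0) τ (hbt τ hτ)).clm_apply (hasDerivAt_const τ (x - x0))))
      hgs
      (fun τ hτ => by
        rw [dist_eq_norm]
        refine (quad_bound (convex_ball p R) (hX.differentiable (by simp)) hL2
          (hhalf (hz x0 hx0 τ hτ).1) (hgs τ hτ)).trans ?_
        have := hAh τ hτ
        calc (K2 : ℝ) * ‖A (x0, τ) (x - x0)‖ ^ 2 ≤ K2 * (2 * ‖x - x0‖) ^ 2 := by gcongr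
          _ = _ := by ring)
      (by simp [hψ0 x (hbr x hx), hψ0 x0 (hbr x0 hx0), hA0 x0 (hbr x0 hx0)]) t ht
    rw [dist_eq_norm] at this
    rw [sub_sub]
    refine this.trans (le_of_eq (by ring))
  refine ⟨ball p d ×ˢ Ioo (-d) d, prod_mem_nhds (ball_mem_nhds _ hd0) (Ioo_mem_nhds (by linarith) hd0), ?_⟩
  rintro ⟨x0, t0⟩ ⟨hx0, ht0⟩
  simp only at hx0 ht0
  set C := K2 * 4 * Real.exp ((K1 + 1) * d) with hC
  rw [hasFDerivAt_iff_isLittleO]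
  have o1 : (fun z : E × ℝ => ψ z - ψ (x0, z.2) - A (x0, z.2) (z.1 - x0)) =o[𝓝 (x0, t0)]
      fun z => z - (x0, t0) := by
    have b1 : (fun z : E × ℝ => ψ z - ψ (x0, z.2) - A (x0, z.2) (z.1 - x0)) =O[𝓝 (x0, t0)]
      fun z => ‖z - (x0, t0)‖ ^ 2 := by
      apply Asymptotics.IsBigO.of_bound C
      have e1 : ∀ᶠ z in 𝓝 (x0, t0), z ∈ ball p d ×ˢ Ioo (-d) d :=
        prod_mem_nhds (isOpen_ball.mem_nhds hx0) (Ioo_mem_nhds ht0.1 ht0.2)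
      have e2 : ∀ᶠ z in 𝓝 (x0, t0), z ∈ ball x0 (R/4) ×ˢ (univ : Set ℝ) :=
        prod_mem_nhds (ball_mem_nhds _ (by positivity)) univ_mem
      filter_upwards [e1, e2] with z h1 h2
      refine (key x0 hx0 z.1 h1.1 (by simpa [dist_eq_norm] using h2.1) z.2 h1.2).trans ?_
      rw [norm_pow, norm_norm]
      have : ‖z.1 - x0‖ ≤ ‖z - (x0, t0)‖ := norm_fst_le (z - (x0, t0))
      gcongr
    refine b1.trans_isLittleO ?_
    have := (Asymptotics.isLittleO_pow_sub_sub (x0, t0) (one_lt_two))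
    exact this
  have o2 : (fun z : E × ℝ => (A (x0, z.2) - A (x0, t0)) (z.1 - x0)) =o[𝓝 (x0, t0)]
      fun z => z - (x0, t0) := by
    have hc : ContinuousAt (fun t => A (x0, t)) t0 :=
      (hA x0 (hbr x0 hx0) t0 (hbt t0 ht0)).continuousAt
    have t1 : Tendsto (fun z : E × ℝ => A (x0, z.2) - A (x0, t0)) (𝓝 (x0, t0)) (𝓝 0) := by
      have : Tendsto (fun z : E × ℝ => A (x0, z.2)) (𝓝 (x0, t0)) (𝓝 (A (x0, t0))) :=
        hc.tendsto.comp (continuous_snd.tendsto (x0, t0))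
      simpa using this.sub_const (A (x0, t0))
    rw [Asymptotics.isLittleO_iff]
    intro c hc'
    have := (tendsto_zero_iff_norm_tendsto_zero.1 t1).eventually (gt_mem_nhds hc')
    filter_upwards [this] with z hz'
    refine ((A (x0, z.2) - A (x0, t0)).le_of_opNorm_le hz'.le _).trans ?_
    have : ‖z.1 - x0‖ ≤ ‖z - (x0, t0)‖ := norm_fst_le (z - (x0, t0))
    gcongr
  have o3 : (fun z : E × ℝ => ψ (x0, z.2) - ψ (x0, t0) - (z.2 - t0) • X (ψ (x0, t0))) =o[𝓝 (x0, t0)]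
      fun z => z - (x0, t0) := by
    have h := (hasDerivAt_iff_isLittleO.1 (hψ x0 (hbr x0 hx0) t0 (hbt t0 ht0))).comp_tendsto
      (continuous_snd.tendsto (x0, t0))
    refine h.trans_isBigO ?_
    apply Asymptotics.IsBigO.of_bound 1
    filter_upwards with z
    rw [one_mul]
    exact norm_snd_le (z - (x0, t0))
  refine ((o1.add o2).add o3).congr_left ?_
  intro z
  simp [ContinuousLinearMap.toSpanSingleton_apply]
  abel

theorem local_flow (k : ℕ) : ∀ (E : Type) [NormedAddCommGroup E] [NormedSpace ℝ E]
    [CompleteSpace E] (X : E → E) (_ : ContDiff ℝ ∞ X) (p : E),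
    ∃ r > 0, ∃ ε > 0, ∃ ψ : E × ℝ → E,
      (∀ x ∈ ball p r, ψ (x, 0) = x ∧
        ∀ t ∈ Ioo (-ε) ε, HasDerivAt (fun t => ψ (x, t)) (X (ψ (x, t))) t) ∧
      ContDiffAt ℝ k ψ (p, 0) := by
  induction k with
  | zero =>
    intro E _ _ _ X hX p
    obtain ⟨ε, hε, a, r, L, K, hr, hpl⟩ := IsPicardLindelof.of_contDiffAt_one
      ((hX.of_le (m := 1) (by exact_mod_cast le_top)).contDiffAt (x := p))
    obtain ⟨ψ, h1, h2⟩ := (hpl 0).exists_forall_mem_closedBall_eq_hasDerivWithinAt_continuousOn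
    simp only [zero_sub, zero_add] at h1 h2
    refine ⟨r, hr, ε, hε, ψ, fun x hx => ⟨(h1 x (ball_subset_closedBall hx)).1, fun t ht =>
      ((h1 x (ball_subset_closedBall hx)).2 t (Ioo_subset_Icc_self ht)).hasDerivAt
        (Icc_mem_nhds ht.1 ht.2)⟩, ?_⟩
    simp only [Nat.cast_zero]
    rw [contDiffAt_zero]
    exact ⟨_, prod_mem_nhds (closedBall_mem_nhds p hr) (Icc_mem_nhds (by linarith) hε), h2⟩
  | succ k ih =>
    intro E _ _ _ X hX p
    let Z : E × (E →L[ℝ] E) → E × (E →L[ℝ] E) :=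
      fun y => (X y.1, (fderiv ℝ X y.1).comp y.2)
    have hZ : ContDiff ℝ ∞ Z := by
      refine (hX.comp contDiff_fst).prodMk ?_
      exact ((hX.fderiv_right (m := ∞) (by simp)).comp contDiff_fst).clm_comp contDiff_snd
    obtain ⟨r, hr, ε, hε, Φ, hΦ, hΦc⟩ := ih _ Z hZ (p, ContinuousLinearMap.id ℝ E)
    let ι : E × ℝ → (E × (E →L[ℝ] E)) × ℝ := fun z => ((z.1, ContinuousLinearMap.id ℝ E), z.2)
    have hι : ContDiff ℝ k ι := by fun_prop
    have hιb : ∀ x ∈ ball p r, (x, ContinuousLinearMap.id ℝ E) ∈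
        ball (p, ContinuousLinearMap.id ℝ E) r := by
      intro x hx
      rw [mem_ball, Prod.dist_eq]
      simpa [hr] using hx
    have hc : ContDiffAt ℝ k (fun z => Φ (ι z)) (p, 0) :=
      ContDiffAt.comp (p, (0 : ℝ)) (g := Φ) (f := ι) hΦc hι.contDiffAt
    have hc1 : ContDiffAt ℝ k (fun z => (Φ (ι z)).1) (p, 0) := hc.fst
    have hc2 : ContDiffAt ℝ k (fun z => (Φ (ι z)).2) (p, 0) := hc.snd
    have hder : ∀ x ∈ ball p r, ∀ t ∈ Ioo (-ε) ε,
        HasDerivAt (fun t => Φ (ι (x, t))) (Z (Φ (ι (x, t)))) t :=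
      fun x hx => (hΦ _ (hιb x hx)).2
    have hd1 : ∀ x ∈ ball p r, ∀ t ∈ Ioo (-ε) ε,
        HasDerivAt (fun t => (Φ (ι (x, t))).1) (X (Φ (ι (x, t))).1) t := fun x hx t ht =>
      (hder x hx t ht).fst
    have hd2 := fun x hx t ht => (hder x hx t ht).snd
    refine ⟨r, hr, ε, hε, fun z => (Φ (ι z)).1, fun x hx => ⟨?_, hd1 x hx⟩, ?_⟩
    · exact congrArg Prod.fst (hΦ _ (hιb x hx)).1
    push_cast
    rw [contDiffAt_succ_iff_hasFDerivAt]
    refine ⟨_, flow_diff hX hr hε (ψ := fun z => (Φ (ι z)).1) (A := fun z => (Φ (ι z)).2)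
      (fun x hx => congrArg Prod.fst (hΦ _ (hιb x hx)).1)
      (fun x hx => congrArg Prod.snd (hΦ _ (hιb x hx)).1) hd1 hd2 hc1.continuousAt hc2.continuousAt, ?_⟩
    have hXc : ContDiffAt ℝ k (fun z => X (Φ (ι z)).1) (p, 0) :=
      (hX.of_le (m := k) (by exact_mod_cast le_top)).contDiffAt.comp (p, (0:ℝ)) hc1
    have e : ∀ (a : E →L[ℝ] E) (b : E), a.coprod (ContinuousLinearMap.toSpanSingleton ℝ b) =
        a.comp (ContinuousLinearMap.fst ℝ E ℝ) +
        (ContinuousLinearMap.snd ℝ E ℝ).smulRight b := by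
      intro a b; ext <;> simp
    simp only [e]
    exact (hc2.clm_comp contDiffAt_const).add (contDiffAt_const.smulRight hXc)

theorem ode_unique {E : Type*} [NormedAddCommGroup E] [NormedSpace ℝ E] [FiniteDimensional ℝ E]
    {X : E → E} (hX : ContDiff ℝ ∞ X) {f g : ℝ → E} {ε : ℝ}
    (hf : ∀ t ∈ Ioo (-ε) ε, HasDerivAt f (X (f t)) t)
    (hg : ∀ t ∈ Ioo (-ε) ε, HasDerivAt g (X (g t)) t) (h0 : f 0 = g 0) :
    ∀ t ∈ Ioo (-ε) ε, f t = g t := by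
  intro t ht
  obtain ⟨d, h1, h2⟩ := exists_between (abs_lt.2 ht)
  have hd0 : 0 < d := (abs_nonneg t).trans_lt h1
  have hsub : Icc (-d) d ⊆ Ioo (-ε) ε := fun τ hτ => ⟨by linarith [hτ.1], by linarith [hτ.2]⟩
  have hfc : ContinuousOn f (Icc (-d) d) := fun τ hτ =>
    (hf τ (hsub hτ)).continuousAt.continuousWithinAt
  have hgc : ContinuousOn g (Icc (-d) d) := fun τ hτ =>
    (hg τ (hsub hτ)).continuousAt.continuousWithinAt
  obtain ⟨R, hR⟩ := ((isCompact_Icc.image_of_continuousOn hfc).union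
    (isCompact_Icc.image_of_continuousOn hgc)).isBounded.subset_closedBall 0
  obtain ⟨K, hK⟩ := (hX.contDiffOn (s := closedBall 0 R)).exists_lipschitzOnWith (by simp)
    (convex_closedBall 0 R) (isCompact_closedBall 0 R)
  refine ODE_solution_unique_of_mem_Icc (v := fun _ => X) (s := fun _ => closedBall 0 R)
    (a := -d) (b := d) (t₀ := 0) (fun _ _ => hK) ⟨by linarith, hd0⟩ hfc
    (fun τ hτ => hf τ (hsub (Ioo_subset_Icc_self hτ)))
    (fun τ hτ => hR (Or.inl ⟨τ, Ioo_subset_Icc_self hτ, rfl⟩)) hgc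
    (fun τ hτ => hg τ (hsub (Ioo_subset_Icc_self hτ)))
    (fun τ hτ => hR (Or.inr ⟨τ, Ioo_subset_Icc_self hτ, rfl⟩)) h0 (abs_le.1 h1.le)

theorem flow_contDiffAt {E : Type} [NormedAddCommGroup E] [NormedSpace ℝ E] [FiniteDimensional ℝ E]
    {X : E → E} (hX : ContDiff ℝ ∞ X) {φ : ℝ → E → E} (h0 : ∀ p, φ 0 p = p)
    (hφ : ∀ t p, HasDerivAt (fun s => φ s p) (X (φ t p)) t) (k : ℕ) (p : E) :
    ContDiffAt ℝ k (fun z : E × ℝ => φ z.2 z.1) (p, 0) := by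
  have : CompleteSpace E := FiniteDimensional.complete ℝ E
  obtain ⟨r, hr, ε, hε, ψ, hψ, hc⟩ := local_flow k E X hX p
  refine hc.congr_of_eventuallyEq ?_
  filter_upwards [prod_mem_nhds (ball_mem_nhds p hr) (Ioo_mem_nhds (neg_lt_zero.2 hε) hε)] with z hz
  exact ode_unique hX (fun t _ => hφ t z.1) (hψ z.1 hz.1).2 (by simp [h0, (hψ z.1 hz.1).1]) z.2 hz.2

theorem flow_neg {E : Type*} [NormedAddCommGroup E] [NormedSpace ℝ E] [FiniteDimensional ℝ E]
    {X : E → E} (hX : ContDiff ℝ ∞ X) {φ : ℝ → E → E} (h0 : ∀ p, φ 0 p = p)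
    (hφ : ∀ t p, HasDerivAt (fun s => φ s p) (X (φ t p)) t) (t : ℝ) (p : E) :
    φ (-t) (φ t p) = p := by
  have := ode_unique hX (f := fun s => φ s (φ t p)) (g := fun s => φ (s + t) p) (ε := |t| + 1)
    (fun s _ => hφ s _) (fun s _ => (hφ (s + t) p).comp_add_const s t) (by simp [h0]) (-t)
    (by rw [mem_Ioo, ← abs_lt]; simp)
  simpa [h0] using this

theorem lift_field {U E : Type*} [NormedAddCommGroup U] [NormedSpace ℝ U] [FiniteDimensional ℝ U]
    [NormedAddCommGroup E] [NormedSpace ℝ E] [FiniteDimensional ℝ E]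
    {F : U → E} {N : Set U} (hN : IsOpen N) (hF : ∀ u ∈ N, ContDiffAt ℝ 2 F u)
    (hinj : ∀ u ∈ N, Function.Injective (fderiv ℝ F u))
    {W : E → E} (hW : ContDiff ℝ ∞ W) (hWt : ∀ u ∈ N, W (F u) ∈ (fderiv ℝ F u).range)
    {u : U} (hu : u ∈ N) :
    ∃ w : U → U, DifferentiableAt ℝ w u ∧ W (F u) = fderiv ℝ F u (w u) ∧
      ∀ v, fderiv ℝ W (F u) (fderiv ℝ F u v) =
        fderiv ℝ F u (fderiv ℝ w u v) + fderiv ℝ (fderiv ℝ F) u v (w u) := by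
  have : CompleteSpace U := FiniteDimensional.complete ℝ U
  obtain ⟨L0, hL0⟩ := LinearMap.exists_leftInverse_of_injective
    (fderiv ℝ F u : U →ₗ[ℝ] E) (LinearMap.ker_eq_bot.2 (hinj u hu))
  let L : E →L[ℝ] U := LinearMap.toContinuousLinearMap L0
  have hL : L.comp (fderiv ℝ F u) = ContinuousLinearMap.id ℝ U := by
    ext x
    exact LinearMap.congr_fun hL0 x
  have hdF : ContDiffAt ℝ 1 (fderiv ℝ F) u :=
    (hF u hu).fderiv_right (m := 1) (by norm_num)
  have hM : ContDiffAt ℝ 1 (fun u' => L.comp (fderiv ℝ F u')) u :=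
    contDiffAt_const.clm_comp hdF
  let w : U → U := fun u' => (ContinuousLinearMap.inverse (L.comp (fderiv ℝ F u'))) (L (W (F u')))
  have hinv : ContDiffAt ℝ 1 (fun u' => ContinuousLinearMap.inverse (L.comp (fderiv ℝ F u'))) u := by
    refine ContDiffAt.comp u (g := ContinuousLinearMap.inverse) ?_ hM
    have := contDiffAt_map_inverse (n := 1) (ContinuousLinearEquiv.refl ℝ U)
    rw [hL]
    exact this
  have hWF : DifferentiableAt ℝ (fun u' => W (F u')) u :=
    (hW.differentiable (by simp) (F u)).comp u ((hF u hu).differentiableAt (by simp))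
  have hw : DifferentiableAt ℝ w u :=
    (hinv.differentiableAt (by simp)).clm_apply (L.differentiableAt.comp u hWF)
  have hev : ∀ᶠ u' in 𝓝 u, W (F u') = fderiv ℝ F u' (w u') := by
    have h1 : ∀ᶠ u' in 𝓝 u, L.comp (fderiv ℝ F u') ∈
        range ((↑) : (U ≃L[ℝ] U) → (U →L[ℝ] U)) := by
      apply hM.continuousAt
      change _ ∈ 𝓝 (L.comp (fderiv ℝ F u))
      rw [hL]
      exact ContinuousLinearEquiv.nhds (ContinuousLinearEquiv.refl ℝ U)
    filter_upwards [h1, hN.mem_nhds hu] with u' ⟨e, he⟩ hu'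
    obtain ⟨c, hc⟩ := hWt u' hu'
    have hwc : w u' = c := by
      simp only [w]
      rw [← he, ContinuousLinearMap.inverse_equiv]
      rw [← hc]
      have : L (fderiv ℝ F u' c) = e c := by
        have := congrArg (fun T : U →L[ℝ] U => T c) he
        exact this.symm
      change e.symm (L (fderiv ℝ F u' c)) = c
      rw [this]; simp
    rw [hwc]; exact hc.symm
  refine ⟨w, hw, hev.self_of_nhds, fun v => ?_⟩
  have e1 : fderiv ℝ (fun u' => W (F u')) u = (fderiv ℝ W (F u)).comp (fderiv ℝ F u) :=
    fderiv_comp u (hW.differentiable (by simp) (F u)) ((hF u hu).differentiableAt (by simp))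
  have e2 := Filter.EventuallyEq.fderiv_eq (𝕜 := ℝ) hev
  rw [e1, fderiv_clm_apply (hdF.differentiableAt (by simp)) hw] at e2
  have := congrArg (fun T : U →L[ℝ] E => T v) e2
  simpa using this

theorem bracket_tangent {U E : Type*} [NormedAddCommGroup U] [NormedSpace ℝ U]
    [FiniteDimensional ℝ U] [NormedAddCommGroup E] [NormedSpace ℝ E] [FiniteDimensional ℝ E]
    {F : U → E} {N : Set U} (hN : IsOpen N) (hF : ∀ u ∈ N, ContDiffAt ℝ 2 F u)
    (hinj : ∀ u ∈ N, Function.Injective (fderiv ℝ F u))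
    {V W : E → E} (hV : ContDiff ℝ ∞ V) (hW : ContDiff ℝ ∞ W)
    (hVt : ∀ u ∈ N, V (F u) ∈ (fderiv ℝ F u).range)
    (hWt : ∀ u ∈ N, W (F u) ∈ (fderiv ℝ F u).range) :
    ∀ u ∈ N, VectorField.lieBracket ℝ V W (F u) ∈ (fderiv ℝ F u).range := by
  intro u hu
  obtain ⟨v, -, hv1, hv2⟩ := lift_field hN hF hinj hV hVt hu
  obtain ⟨w, -, hw1, hw2⟩ := lift_field hN hF hinj hW hWt hu
  have hsymm : IsSymmSndFDerivAt ℝ F u := (hF u hu).isSymmSndFDerivAt (by simp)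
  refine ⟨fderiv ℝ w u (v u) - fderiv ℝ v u (w u), ?_⟩
  rw [VectorField.lieBracket_eq]
  simp only
  rw [hv1, hw1, hw2, hv2, hsymm.eq (v u) (w u)]
  simp

def ReachC {E : Type*} [TopologicalSpace E] (O : E → E → Prop) (x y : E) : Prop :=
  ∃ G : E → E, ContinuousAt G x ∧ G x = y ∧ ∀ z, O z (G z)

theorem ReachC.trans {E : Type*} [TopologicalSpace E] {O : E → E → Prop}
    (hO : ∀ a b c, O a b → O b c → O a c) {x y z : E} (h1 : ReachC O x y) (h2 : ReachC O y z) :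
    ReachC O x z := by
  obtain ⟨G, hG, rfl, hGO⟩ := h1
  obtain ⟨H, hH, rfl, hHO⟩ := h2
  exact ⟨fun a => H (G a), hH.comp hG, rfl, fun a => hO _ _ _ (hGO a) (hHO _)⟩

def HasSlice {E : Type} [NormedAddCommGroup E] [NormedSpace ℝ E] (S : E → Prop) (k : ℕ) : Prop :=
  ∃ (U : Type) (_ : NormedAddCommGroup U) (_ : NormedSpace ℝ U) (_ : FiniteDimensional ℝ U),
    Module.finrank ℝ U = k ∧ ∃ (F : U → E) (u0 : U), ContDiffAt ℝ 2 F u0 ∧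
      Function.Injective (fderiv ℝ F u0) ∧ ∀ᶠ u in 𝓝 u0, S (F u)

theorem flow_fderiv {E : Type} [NormedAddCommGroup E] [NormedSpace ℝ E]
    {X : E → E} {φ : ℝ → E → E} (h0 : ∀ p, φ 0 p = p)
    (hφ : ∀ t p, HasDerivAt (fun s => φ s p) (X (φ t p)) t) (p : E)
    (hd : DifferentiableAt ℝ (fun z : E × ℝ => φ z.2 z.1) (p, 0)) (a : E) (b : ℝ) :
    fderiv ℝ (fun z : E × ℝ => φ z.2 z.1) (p, 0) (a, b) = a + b • X p := by
  set D := fderiv ℝ (fun z : E × ℝ => φ z.2 z.1) (p, 0) with hD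
  have hDd : HasFDerivAt (fun z : E × ℝ => φ z.2 z.1) D (p, 0) := hd.hasFDerivAt
  have h1 : D (a, 0) = a := by
    have := HasFDerivAt.comp (x := p) (f := fun x : E => (x, (0 : ℝ))) hDd
      ((hasFDerivAt_id p).prodMk (hasFDerivAt_const (0 : ℝ) p))
    have h2 : HasFDerivAt ((fun z : E × ℝ => φ z.2 z.1) ∘ fun x : E => (x, (0 : ℝ)))
        (ContinuousLinearMap.id ℝ E) p := by
      have : ((fun z : E × ℝ => φ z.2 z.1) ∘ fun x : E => (x, (0 : ℝ))) = id := by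
        ext x; simp [h0]
      rw [this]; exact hasFDerivAt_id p
    have := congrArg (fun T : E →L[ℝ] E => T a) (this.unique h2)
    simpa using this
  have h2 : D (0, 1) = X p := by
    have := HasFDerivAt.comp_hasDerivAt (x := (0 : ℝ)) (f := fun t : ℝ => (p, t)) hDd
      ((hasDerivAt_const (0 : ℝ) p).prodMk (hasDerivAt_id (0 : ℝ)))
    have h3 := hφ 0 p
    rw [h0] at h3
    exact this.unique h3
  have : ((a, b) : E × ℝ) = (a, 0) + b • ((0 : E), (1 : ℝ)) := by simp
  rw [this, map_add, map_smul, h1, h2]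

theorem slice_step {E ι : Type} [NormedAddCommGroup E] [NormedSpace ℝ E] [FiniteDimensional ℝ E]
    {X : ι → E → E} (hX : ∀ i, ContDiff ℝ ∞ (X i)) {φ : ι → ℝ → E → E} (h0 : ∀ i p, φ i 0 p = p)
    (hφ : ∀ i t p, HasDerivAt (fun s => φ i s p) (X i (φ i t p)) t)
    {O : E → E → Prop} (hO : ∀ a b c, O a b → O b c → O a c) (hOφ : ∀ i t a, O a (φ i t a))
    {B : (E → E) → Prop}
    (hB : ∀ P : (E → E) → Prop, (∀ i, P (X i)) →
      (∀ V W, P V → P W → P (VectorField.lieBracket ℝ V W)) → ∀ V, B V → P V)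
    (hspan : ∀ p, Submodule.span ℝ {v : E | ∃ V, B V ∧ V p = v} = ⊤)
    {p : E} {k : ℕ} (hk : k < Module.finrank ℝ E) (hS : HasSlice (ReachC O p) k) :
    HasSlice (ReachC O p) (k + 1) := by
  obtain ⟨U, _, _, _, hU, F, u0, hF, hinj, hR⟩ := hS
  have : CompleteSpace U := FiniteDimensional.complete ℝ U
  have : CompleteSpace E := FiniteDimensional.complete ℝ E
  have ev2 : ∀ᶠ u in 𝓝 u0, Function.Injective (fderiv ℝ F u) := by
    have hc : ContinuousAt (fderiv ℝ F) u0 :=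
      (hF.fderiv_right (m := 1) (by norm_num)).continuousAt
    exact hc.eventually (ContinuousLinearMap.isOpen_injective.mem_nhds hinj)
  have ev1 := hF.eventually (by simp)
  obtain ⟨N, hNs, hN, hu0⟩ := _root_.mem_nhds_iff.1 ((ev1.and ev2).and hR)
  by_cases hex : ∃ u ∈ N, ∃ i, X i (F u) ∉ (fderiv ℝ F u).range
  · obtain ⟨u, hu, i, hi⟩ := hex
    obtain ⟨⟨hFu, hiu⟩, -⟩ := hNs hu
    have hΨ := flow_contDiffAt (hX i) (h0 i) (hφ i) 2 (F u)
    have hι : ContDiffAt ℝ 2 (fun z : U × ℝ => (F z.1, z.2)) (u, 0) :=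
      (ContDiffAt.comp (u, (0 : ℝ)) (g := F) (f := Prod.fst) hFu contDiffAt_fst).prodMk contDiffAt_snd
    refine ⟨U × ℝ, inferInstance, inferInstance, inferInstance, by simp [hU],
      fun z => φ i z.2 (F z.1), (u, 0), ?_, ?_, ?_⟩
    · exact ContDiffAt.comp (u, (0 : ℝ)) (g := fun z : E × ℝ => φ i z.2 z.1) hΨ hι
    · have hd := hΨ.differentiableAt (by simp)
      have hιd : HasFDerivAt (fun z : U × ℝ => (F z.1, z.2))
          (((fderiv ℝ F u).comp (ContinuousLinearMap.fst ℝ U ℝ)).prod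
            (ContinuousLinearMap.snd ℝ U ℝ)) (u, 0) :=
        (HasFDerivAt.comp (u, (0 : ℝ)) (g := F) (f := Prod.fst)
          (hFu.differentiableAt (by simp)).hasFDerivAt hasFDerivAt_fst).prodMk hasFDerivAt_snd
      have hcomp := HasFDerivAt.comp (u, (0 : ℝ)) (g := fun z : E × ℝ => φ i z.2 z.1)
        (f := fun z : U × ℝ => (F z.1, z.2)) hd.hasFDerivAt hιd
      have hfd : ∀ a b, fderiv ℝ (fun z : U × ℝ => φ i z.2 (F z.1)) (u, 0) (a, b) =
          fderiv ℝ F u a + b • X i (F u) := by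
        intro a b
        rw [← flow_fderiv (h0 i) (hφ i) (F u) hd]
        exact congrArg (fun T : U × ℝ →L[ℝ] E => T (a, b)) hcomp.fderiv
      rw [injective_iff_map_eq_zero]
      rintro ⟨a, b⟩ hab
      rw [hfd] at hab
      have hb : b = 0 := by
        by_contra hb
        apply hi
        refine ⟨(-b⁻¹) • a, ?_⟩
        have : b • X i (F u) = - fderiv ℝ F u a := (neg_eq_of_add_eq_zero_right hab).symm
        have h2 : X i (F u) = b⁻¹ • (b • X i (F u)) := by
          rw [smul_smul, inv_mul_cancel₀ hb, one_smul]
        rw [h2, this]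
        simp
      subst hb
      have ha : a = 0 := hiu (by simpa using hab)
      simp [ha]
    · have hr : ∀ᶠ z : U × ℝ in 𝓝 (u, 0), ReachC O p (F z.1) := by
        have : ∀ᶠ u' in 𝓝 u, ReachC O p (F u') :=
          mem_of_superset (hN.mem_nhds hu) (fun u' hu' => (hNs hu').2)
        exact (continuous_fst.tendsto (u, (0 : ℝ))).eventually this
      have hc : ∀ᶠ z : U × ℝ in 𝓝 (u, 0),
          ContDiffAt ℝ 2 (fun z : E × ℝ => φ i z.2 z.1) (F z.1, z.2) :=
        hι.continuousAt.eventually (hΨ.eventually (by simp))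
      filter_upwards [hr, hc] with z h1 h2
      refine h1.trans hO ⟨φ i z.2, ?_, rfl, hOφ i z.2⟩
      exact ContinuousAt.comp (x := F z.1) (f := fun x : E => (x, z.2)) h2.continuousAt
        (by fun_prop)
  · push Not at hex
    exfalso
    have hall : ∀ V, B V → ContDiff ℝ ∞ V ∧ ∀ u ∈ N, V (F u) ∈ (fderiv ℝ F u).range := by
      apply hB
      · exact fun i => ⟨hX i, fun u hu => hex u hu i⟩
      · intro V W hV hW
        exact ⟨hV.1.lieBracket_vectorField hW.1 (by simp),
          bracket_tangent hN (fun u hu => (hNs hu).1.1) (fun u hu => (hNs hu).1.2)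
            hV.1 hW.1 hV.2 hW.2⟩
    have htop : (fderiv ℝ F u0).range = ⊤ := by
      rw [eq_top_iff, ← hspan (F u0), Submodule.span_le]
      rintro v ⟨V, hV, rfl⟩
      exact (hall V hV).2 u0 hu0
    have := LinearMap.finrank_le_finrank_of_surjective (f := (fderiv ℝ F u0 : U →ₗ[ℝ] E))
      (LinearMap.range_eq_top.1 htop)
    omega

theorem reach_open {E ι : Type} [NormedAddCommGroup E] [NormedSpace ℝ E] [FiniteDimensional ℝ E]
    {X : ι → E → E} (hX : ∀ i, ContDiff ℝ ∞ (X i)) {φ : ι → ℝ → E → E} (h0 : ∀ i p, φ i 0 p = p)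
    (hφ : ∀ i t p, HasDerivAt (fun s => φ i s p) (X i (φ i t p)) t)
    {O : E → E → Prop} (hO : ∀ a b c, O a b → O b c → O a c) (hOr : ∀ a, O a a)
    (hOs : ∀ a b, O a b → O b a) (hOφ : ∀ i t a, O a (φ i t a))
    {B : (E → E) → Prop}
    (hB : ∀ P : (E → E) → Prop, (∀ i, P (X i)) →
      (∀ V W, P V → P W → P (VectorField.lieBracket ℝ V W)) → ∀ V, B V → P V)
    (hspan : ∀ p, Submodule.span ℝ {v : E | ∃ V, B V ∧ V p = v} = ⊤) (p : E) :
    {x | O p x} ∈ 𝓝 p := by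
  have : CompleteSpace E := FiniteDimensional.complete ℝ E
  have hall : ∀ k, k ≤ Module.finrank ℝ E → HasSlice (ReachC O p) k := by
    intro k
    induction k with
    | zero =>
      intro _
      refine ⟨Fin 0 → ℝ, inferInstance, inferInstance, inferInstance, by simp, fun _ => p, 0,
        contDiffAt_const, Function.injective_of_subsingleton _, ?_⟩
      exact Eventually.of_forall fun _ => ⟨id, continuousAt_id, rfl, hOr⟩
    | succ k ih =>
      intro hk
      exact slice_step hX h0 hφ hO hOφ hB hspan (by omega) (ih (by omega))
  obtain ⟨U, _, _, _, hU, F, u0, hF, hinj, hR⟩ := hall _ le_rfl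
  have : CompleteSpace U := FiniteDimensional.complete ℝ U
  have hsurj : (fderiv ℝ F u0).range = ⊤ := by
    apply LinearMap.range_eq_top.2
    exact (LinearMap.injective_iff_surjective_of_finrank_eq_finrank
      (f := (fderiv ℝ F u0 : U →ₗ[ℝ] E)) hU).1 hinj
  have hmap := (hF.hasStrictFDerivAt (by simp)).map_nhds_eq_of_surj hsurj
  have hnh : ∀ᶠ y in 𝓝 (F u0), ReachC O p y := by
    rw [← hmap]; exact hR
  obtain ⟨G, hG, hGp, hGO⟩ := hR.self_of_nhds
  rw [← hGp] at hnh
  filter_upwards [hG.eventually hnh] with z hz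
  obtain ⟨H, -, hHp, hHO⟩ := hz
  have h1 : O p (G z) := hHp ▸ hHO p
  exact hO _ _ _ h1 (hOs _ _ (hGO z))

theorem reach_all {E : Type} [NormedAddCommGroup E] [NormedSpace ℝ E]
    {O : E → E → Prop} (hO : ∀ a b c, O a b → O b c → O a c) (hOr : ∀ a, O a a)
    (hOs : ∀ a b, O a b → O b a) (hn : ∀ p, {x | O p x} ∈ 𝓝 p) (p q : E) : O p q := by
  have hop : ∀ p, IsOpen {x | O p x} := by
    intro p
    rw [isOpen_iff_mem_nhds]
    intro x hx
    exact mem_of_superset (hn x) (fun y hy => hO _ _ _ hx hy)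
  have hcl : IsClosed {x | O p x} := by
    rw [← isOpen_compl_iff, isOpen_iff_mem_nhds]
    intro x hx
    exact mem_of_superset (hn x) (fun y hy hy' => hx (hO _ _ _ hy' (hOs _ _ hy)))
  have := IsClopen.eq_univ ⟨hcl, hop p⟩ ⟨p, hOr p⟩
  have hq : q ∈ {x | O p x} := this ▸ mem_univ q
  exact hq

/-- **Chow–Rashevskii theorem.** If `X₁, …, X_m` are smooth vector fields on `ℝⁿ` with
global flows `φ₁, …, φ_m`, and the family is bracket generating (the values at every
point of all iterated Lie brackets span `ℝⁿ`), then any two points of `ℝⁿ` can be joined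
by a concatenation of integral-curve arcs of the `X i`. -/
theorem chow_rashevskii {n m : ℕ} (X : Fin m → (Fin n → ℝ) → (Fin n → ℝ))
    (hX : ∀ i, ContDiff ℝ (⊤ : ℕ∞) (X i))
    (φ : Fin m → ℝ → (Fin n → ℝ) → (Fin n → ℝ))
    (hφ0 : ∀ i p, φ i 0 p = p)
    (hφ : ∀ i t p, HasDerivAt (fun s => φ i s p) (X i (φ i t p)) t)
    (hbg : ∀ p : Fin n → ℝ,
      Submodule.span ℝ {v : Fin n → ℝ | ∃ V, IsIteratedBracket X V ∧ V p = v} = ⊤) :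
    ∀ p q : Fin n → ℝ, ∃ (k : ℕ) (i : Fin k → Fin m) (t : Fin k → ℝ),
      steer φ k i t p = q := by
  intro p q
  let S : (Fin n → ℝ) → (Fin n → ℝ) → Prop := fun a b => ∃ i t, φ i t a = b
  have hSs : Std.Symm S := ⟨by
    rintro a b ⟨i, t, rfl⟩
    exact ⟨i, -t, flow_neg (hX i) (hφ0 i) (hφ i) t a⟩⟩
  have hT : ∀ a b c, Relation.ReflTransGen S a b → Relation.ReflTransGen S b c →
      Relation.ReflTransGen S a c := fun a b c h1 h2 => h1.trans h2
  have hsym : ∀ a b, Relation.ReflTransGen S a b → Relation.ReflTransGen S b a := by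
    intro a b h
    induction h with
    | refl => exact .refl
    | tail _ h ih => exact .head (hSs.symm _ _ h) ih
  have main : Relation.ReflTransGen S p q := by
    refine reach_all hT (fun a => .refl) hsym (fun p => ?_) p q
    refine reach_open hX hφ0 hφ hT (fun a => .refl) hsym (fun i t a => .single ⟨i, t, rfl⟩)
      (B := IsIteratedBracket X) ?_ hbg p
    intro P h1 h2 V hV
    induction hV with
    | base i => exact h1 i
    | bracket _ _ ihV ihW => exact h2 _ _ ihV ihW
  induction main with
  | refl => exact ⟨0, Fin.elim0, Fin.elim0, rfl⟩
  | tail _ h ih =>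
    obtain ⟨k, i, t, rfl⟩ := ih
    obtain ⟨j, s, rfl⟩ := h
    refine ⟨k + 1, Fin.snoc i j, Fin.snoc t s, ?_⟩
    simp [steer]
end

section
/- (Frobenius) Let Δ : ℝ^n → Submodule ℝ ℝ^n assign to each point a k-dimensional subspace of ℝ^n, and assume Δ is smooth in the sense that around every point there exist smooth (C^∞) vector fields V₁, …, V_k defined on a neighborhood whose values span Δ(x) at every x in that neighborhood. Assume Δ is involutive: for any two smooth vector fields X, Y defined on an open set with X(x) ∈ Δ(x) and Y(x) ∈ Δ(x) for all x in that set, also [X,Y](x) ∈ Δ(x) for all x in that set. Then Δ is locally straightenable: for every p ∈ ℝ^n there is an open neighborhood U of p and a C^∞ diffeomorphism ψ from U onto an open subset of ℝ^n such that for every q ∈ U, the derivative Dψ(q) maps Δ(q) onto the coordinate subspace ℝ^k × {0} ⊆ ℝ^n spanned by the first k standard basis vectors. -/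
namespace Frob

open Set Filter Topology

set_option linter.unusedSectionVars false

/-- the unit interval -/
abbrev K : Type := Set.Icc (0:ℝ) 1

section nem
variable {E F G : Type} [NormedAddCommGroup E] [NormedSpace ℝ E]
  [NormedAddCommGroup F] [NormedSpace ℝ F] [NormedAddCommGroup G] [NormedSpace ℝ G]

/-- pointwise application -/
noncomputable def app : C(K, E →L[ℝ] F) →L[ℝ] C(K, E) →L[ℝ] C(K, F) :=
  LinearMap.mkContinuous₂
    (LinearMap.mk₂ ℝ (fun (a : C(K, E →L[ℝ] F)) (b : C(K, E)) =>
        (⟨fun t => a t (b t), a.continuous.clm_apply b.continuous⟩ : C(K, F)))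
      (by intros; ext; simp) (by intros; ext; simp) (by intros; ext; simp)
      (by intros; ext; simp)) 1 (by
    intro a b
    rw [ContinuousMap.norm_le _ (by positivity)]
    intro t
    simp only [LinearMap.mk₂_apply, ContinuousMap.coe_mk, one_mul]
    exact (a t).le_of_opNorm_le_of_le (a.norm_coe_le_norm t) (b.norm_coe_le_norm t))

@[simp] lemma app_apply (a : C(K, E →L[ℝ] F)) (b : C(K, E)) (t : K) :
    app a b t = a t (b t) := rfl

lemma app_hasFDerivAt (a : C(K, E →L[ℝ] F)) :
    HasFDerivAt (fun a : C(K, E →L[ℝ] F) => app a) (app (E := E) (F := F)) a :=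
  ContinuousLinearMap.hasFDerivAt (F := C(K, E) →L[ℝ] C(K, F)) app

lemma app_contDiff (n : WithTop ℕ∞) :
    ContDiff ℝ n (fun a : C(K, E →L[ℝ] F) => app a) :=
  ContinuousLinearMap.contDiff (𝕜 := ℝ) (E := C(K, E →L[ℝ] F)) (F := C(K, E) →L[ℝ] C(K, F))
    (n := n) (app (E := E) (F := F))

/-- composition operator -/
noncomputable def nem (g : E → F) (hg : Continuous g) (b : C(K, E)) : C(K, F) :=
  (⟨g, hg⟩ : C(E, F)).comp b

@[simp] lemma nem_apply (g : E → F) (hg : Continuous g) (b : C(K, E)) (t : K) :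
    nem g hg b t = g (b t) := rfl

lemma nem_continuous (g : E → F) (hg : Continuous g) : Continuous (nem g hg) :=
  ContinuousMap.continuous_postcomp _

lemma nem_hasFDerivAt (g : E → F) (hg : ContDiff ℝ 1 g) (b : C(K, E)) :
    HasFDerivAt (nem g hg.continuous)
      (app (nem (fderiv ℝ g) (hg.continuous_fderiv one_ne_zero) b)) b := by
  rw [hasFDerivAt_iff_isLittleO, Asymptotics.isLittleO_iff]
  intro c hc
  have hN := nem_continuous (fderiv ℝ g) (hg.continuous_fderiv one_ne_zero)
  obtain ⟨δ, hδ, H⟩ := Metric.continuousAt_iff.1 (hN.continuousAt (x := b)) c hc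
  filter_upwards [Metric.ball_mem_nhds b hδ] with b' hb'
  rw [ContinuousMap.norm_le _ (by positivity)]
  intro t
  have hkey : ∀ y ∈ Metric.ball (b t) δ, ‖fderiv ℝ g y - fderiv ℝ g (b t)‖ ≤ c := by
    intro y hy
    have h1 : dist (b + ContinuousMap.const K (y - b t)) b < δ := by
      rw [dist_eq_norm, add_sub_cancel_left, ContinuousMap.norm_lt_iff _ hδ]
      intro s
      simpa [dist_eq_norm] using hy
    have h2 := H h1
    rw [dist_eq_norm, ContinuousMap.norm_lt_iff _ hc] at h2
    have h3 := h2 t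
    simp at h3
    exact h3.le
  have h4 := (convex_ball (b t) δ).norm_image_sub_le_of_norm_hasFDerivWithin_le'
    (f := g) (f' := fderiv ℝ g) (φ := fderiv ℝ g (b t)) (C := c)
    (fun x _ => ((hg.differentiable one_ne_zero) x).hasFDerivAt.hasFDerivWithinAt)
    hkey (Metric.mem_ball_self hδ)
    (show b' t ∈ Metric.ball (b t) δ from lt_of_le_of_lt (ContinuousMap.dist_apply_le_dist t) hb')
  refine h4.trans ?_
  gcongr
  exact (b' - b).norm_coe_le_norm t

lemma nem_contDiff_nat (n : ℕ) : ∀ {F : Type} [NormedAddCommGroup F] [NormedSpace ℝ F]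
    (g : E → F) (hg : ContDiff ℝ n g), ContDiff ℝ n (nem g hg.continuous) := by
  induction n with
  | zero =>
    intro F _ _ g hg
    have := nem_continuous g hg.continuous
    exact_mod_cast contDiff_zero.2 this
  | succ n ih =>
    intro F _ _ g hg
    have hg1 : ContDiff ℝ 1 g := hg.of_le (by exact_mod_cast Nat.le_add_left 1 n)
    have hg' : ContDiff ℝ n (fderiv ℝ g) := hg.fderiv_right (by norm_cast)
    push_cast
    rw [contDiff_succ_iff_hasFDerivAt]
    have h := (app_contDiff n (E := E) (F := F)).comp (ih _ hg')
    exact ⟨_, h, fun b => nem_hasFDerivAt g hg1 b⟩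

lemma nem_contDiff (g : E → F) (hg : ContDiff ℝ (⊤ : ℕ∞) g) :
    ContDiff ℝ (⊤ : ℕ∞) (nem g hg.continuous) := by
  rw [contDiff_infty]
  intro n
  exact nem_contDiff_nat n g (hg.of_le (by exact_mod_cast le_top))

/-- integration operator -/
noncomputable def integ : C(K, E) →L[ℝ] C(K, E) :=
  LinearMap.mkContinuous
    { toFun := fun f => ⟨fun t => ∫ s in (0:ℝ)..t, Set.IccExtend zero_le_one f s, by
        have : Continuous (Set.IccExtend (zero_le_one (α := ℝ)) f) := f.continuous.Icc_extend'
        exact (intervalIntegral.continuous_primitive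
          (fun a b => this.intervalIntegrable a b) 0).comp continuous_subtype_val⟩
      map_add' := by
        intro f g
        ext t
        have hf : Continuous (Set.IccExtend (zero_le_one (α := ℝ)) f) := f.continuous.Icc_extend'
        have hg : Continuous (Set.IccExtend (zero_le_one (α := ℝ)) g) := g.continuous.Icc_extend'
        simp only [ContinuousMap.coe_mk, ContinuousMap.add_apply]
        rw [← intervalIntegral.integral_add (hf.intervalIntegrable _ _) (hg.intervalIntegrable _ _)]
        rfl
      map_smul' := by
        intro c f
        ext t
        simp only [ContinuousMap.coe_mk, ContinuousMap.smul_apply, RingHom.id_apply]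
        rw [← intervalIntegral.integral_smul]
        rfl } 1 (by
    intro f
    rw [ContinuousMap.norm_le _ (by positivity)]
    intro t
    simp only [LinearMap.coe_mk, AddHom.coe_mk, ContinuousMap.coe_mk]
    have := intervalIntegral.norm_integral_le_of_norm_le_const (a := (0:ℝ)) (b := t) (C := ‖f‖)
      (f := Set.IccExtend zero_le_one f) (fun x _ => f.norm_coe_le_norm _)
    refine this.trans ?_
    rw [sub_zero, abs_of_nonneg t.2.1, one_mul]
    exact mul_le_of_le_one_right (norm_nonneg _) t.2.2)

lemma integ_apply (f : C(K, E)) (t : K) :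
    integ f t = ∫ s in (0:ℝ)..t, Set.IccExtend zero_le_one f s := rfl

/-- constants -/
noncomputable def cst : E →L[ℝ] C(K, E) :=
  LinearMap.mkContinuous
    { toFun := fun x => ContinuousMap.const K x
      map_add' := by intros; ext; simp
      map_smul' := by intros; ext; simp } 1 (by
    intro f
    rw [ContinuousMap.norm_le _ (by positivity)]
    intro t
    simp)

@[simp] lemma cst_apply (x : E) (t : K) : cst x t = x := rfl

/-- evaluation at one -/
noncomputable def ev1 : C(K, E) →L[ℝ] E :=
  LinearMap.mkContinuous
    { toFun := fun f => f 1
      map_add' := by intros; simp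
      map_smul' := by intros; simp } 1 (by
    intro f
    rw [one_mul]
    exact f.norm_coe_le_norm 1)

@[simp] lemma ev1_apply (f : C(K, E)) : ev1 f = f 1 := rfl

/-- the curve `t ↦ (t x, b t)` -/
noncomputable def crv : E × C(K, F) →L[ℝ] C(K, E × F) :=
  LinearMap.mkContinuous
    { toFun := fun z => ⟨fun t => ((t:ℝ) • z.1, z.2 t), by fun_prop⟩
      map_add' := by intros; ext <;> simp
      map_smul' := by intro c z; ext t <;> simp; exact smul_comm _ _ _ } 1 (by
    intro z
    rw [ContinuousMap.norm_le _ (by positivity)]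
    intro t
    rw [one_mul]
    refine max_le ?_ ?_
    · refine le_trans ?_ (norm_fst_le z)
      change ‖(t:ℝ) • z.1‖ ≤ _
      rw [norm_smul, Real.norm_eq_abs, abs_of_nonneg t.2.1]
      exact mul_le_of_le_one_left (norm_nonneg _) t.2.2
    · exact (z.2.norm_coe_le_norm t).trans (norm_snd_le z))

@[simp] lemma crv_apply (z : E × C(K, F)) (t : K) : crv z t = ((t:ℝ) • z.1, z.2 t) := rfl

end nem

lemma inverse_fun {E F : Type*} [NormedAddCommGroup E] [NormedSpace ℝ E] [CompleteSpace E]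
    [NormedAddCommGroup F] [NormedSpace ℝ F]
    (f : E → F) (U : Set E) (hU : IsOpen U) (a : E) (ha : a ∈ U)
    (hf : ContDiffOn ℝ (⊤ : ℕ∞) f U) (e : E ≃L[ℝ] F) (he : HasFDerivAt f (e : E →L[ℝ] F) a) :
    ∃ G : OpenPartialHomeomorph E F, a ∈ G.source ∧ G.source ⊆ U ∧ (G : E → F) = f ∧
      ContDiffOn ℝ (⊤ : ℕ∞) G.symm G.target ∧
      ∀ x ∈ G.source, ∃ e' : E ≃L[ℝ] F, HasFDerivAt f (e' : E →L[ℝ] F) x := by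
  have hfa : ∀ x ∈ U, ContDiffAt ℝ (⊤ : ℕ∞) f x := fun x hx => hf.contDiffAt (hU.mem_nhds hx)
  have hne : ((⊤ : ℕ∞) : WithTop ℕ∞) ≠ 0 := by simp
  let G0 := (hfa a ha).toOpenPartialHomeomorph f he hne
  have hG0 : (G0 : E → F) = f := rfl
  have ha0 : a ∈ G0.source := (hfa a ha).mem_toOpenPartialHomeomorph_source he hne
  have hcont : ContinuousOn (fderiv ℝ f) U := hf.continuousOn_fderiv_of_isOpen hU (by simp)
  have hopen : IsOpen (U ∩ fderiv ℝ f ⁻¹' (range ((↑) : (E ≃L[ℝ] F) → E →L[ℝ] F))) :=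
    hcont.isOpen_inter_preimage hU ContinuousLinearEquiv.isOpen
  refine ⟨G0.restrOpen _ hopen, ⟨ha0, ha, ⟨e, he.fderiv.symm⟩⟩, fun x hx => hx.2.1, rfl, ?_, ?_⟩
  · intro y hy
    have hs := (G0.restrOpen _ hopen).map_target hy
    obtain ⟨e', he'⟩ := hs.2.2
    have hU' := hs.2.1
    refine ((G0.restrOpen _ hopen).contDiffAt_symm (f₀' := e') hy ?_ (hfa _ hU')).contDiffWithinAt
    rw [he']
    exact ((hfa _ hU').differentiableAt hne).hasFDerivAt
  · intro x hx
    obtain ⟨e', he'⟩ := hx.2.2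
    refine ⟨e', ?_⟩
    rw [he']
    exact ((hfa _ hx.2.1).differentiableAt hne).hasFDerivAt

section core
variable {P Q : Type} [NormedAddCommGroup P] [NormedSpace ℝ P]
  [NormedAddCommGroup Q] [NormedSpace ℝ Q] [CompleteSpace Q]

lemma integ_deriv (f : C(K, Q)) (t : ℝ) :
    HasDerivAt (fun t : ℝ => ∫ s in (0:ℝ)..t, Set.IccExtend zero_le_one f s)
      (Set.IccExtend zero_le_one f t) t := by
  have : Continuous (Set.IccExtend (zero_le_one (α := ℝ)) f) := f.continuous.Icc_extend'
  exact intervalIntegral.integral_hasDerivAt_right (this.intervalIntegrable _ _)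
    (this.stronglyMeasurableAtFilter _ _) this.continuousAt

lemma ode_step (A : P × Q → P →L[ℝ] Q) (hA : ContDiff ℝ (⊤ : ℕ∞) A)
    (hA' : Continuous (fderiv ℝ A)) (x v : P) (y : Q)
    (b g : C(K, Q))
    (hb : b = cst y + integ (app (nem A hA.continuous (crv (x, b))) (cst x)))
    (hg : g = integ (app (app (nem (fderiv ℝ A) hA' (crv (x, b))) (crv (v, g))) (cst x)
        + app (nem A hA.continuous (crv (x, b))) (cst v)))
    (hint : ∀ t : K, ∀ v w, fderiv ℝ A (crv (x, b) t) (v, A (crv (x, b) t) v) w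
        = fderiv ℝ A (crv (x, b) t) (w, A (crv (x, b) t) w) v) :
    g 1 = A (x, b 1) v := by
  set f1 := app (nem A hA.continuous (crv (x, b))) (cst x) with hf1
  set f2 := app (app (nem (fderiv ℝ A) hA' (crv (x, b))) (crv (v, g))) (cst x)
        + app (nem A hA.continuous (crv (x, b))) (cst v) with hf2
  let B : ℝ → Q := fun t => y + ∫ s in (0:ℝ)..t, Set.IccExtend zero_le_one f1 s
  let G : ℝ → Q := fun t => ∫ s in (0:ℝ)..t, Set.IccExtend zero_le_one f2 s
  have hB : ∀ t, HasDerivAt B (Set.IccExtend zero_le_one f1 t) t := fun t =>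
    (integ_deriv f1 t).const_add y
  have hG : ∀ t, HasDerivAt G (Set.IccExtend zero_le_one f2 t) t := fun t => integ_deriv f2 t
  have hBb : ∀ t : K, B t = b t := by
    intro t
    conv_rhs => rw [hb]
    rfl
  have hGg : ∀ t : K, G t = g t := by
    intro t
    conv_rhs => rw [hg]
    rfl
  let D : ℝ → Q := fun t => G t - t • A (t • x, B t) v
  have hAd : Differentiable ℝ A := hA.differentiable (by simp)
  have hD : ∀ t, HasDerivAt D (Set.IccExtend zero_le_one f2 t - (t • fderiv ℝ A (t • x, B t)
      (x, Set.IccExtend zero_le_one f1 t) v + (1:ℝ) • A (t • x, B t) v)) t := by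
    intro t
    have h1 : HasDerivAt (fun t : ℝ => (t • x, B t)) ((1:ℝ) • x, Set.IccExtend zero_le_one f1 t) t :=
      ((hasDerivAt_id t).smul_const x).prodMk (hB t)
    rw [one_smul] at h1
    have h2 := (hAd (t • x, B t)).hasFDerivAt.comp_hasDerivAt t h1
    have h3 := h2.clm_apply (hasDerivAt_const t v)
    have h4 := (hasDerivAt_id t).smul h3
    refine ((hG t).sub h4).congr_deriv ?_
    simp
  have hzero := eq_zero_of_abs_deriv_le_mul_abs_self_of_eq_zero_right (f := D) (a := 0) (b := 1)
    (K := ‖nem (fderiv ℝ A) hA' (crv (x, b))‖ * ‖x‖)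
    (fun t _ => (hD t).continuousAt.continuousWithinAt) (fun t _ => (hD t).hasDerivWithinAt)
    (by simp [D, G]) (by
      intro t ht
      let τ : K := ⟨t, ht.1, ht.2.le⟩
      have e1 : Set.IccExtend zero_le_one f1 t = f1 τ := Set.IccExtend_of_mem _ _ τ.2
      have e2 : Set.IccExtend zero_le_one f2 t = f2 τ := Set.IccExtend_of_mem _ _ τ.2
      have hi := hint τ v x
      have hc : crv (x, b) τ = (t • x, B t) := by
        rw [crv_apply, ← hBb τ]
      have hc2 : crv (v, g) τ = (t • v, G t) := by
        rw [crv_apply, ← hGg τ]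
      have : Set.IccExtend zero_le_one f2 t - (t • fderiv ℝ A (t • x, B t)
          (x, Set.IccExtend zero_le_one f1 t) v + (1:ℝ) • A (t • x, B t) v)
          = nem (fderiv ℝ A) hA' (crv (x, b)) τ (0, D t) x := by
        rw [e1, e2]
        simp only [hf1, hf2, ContinuousMap.add_apply, app_apply, nem_apply, cst_apply]
        rw [hc] at hi ⊢
        rw [hc2, ← hi]
        have : ((0 : P), D t) = (t • v, G t) - t • (v, A (t • x, B t) v) := by
          simp [D]
        rw [this]
        simp only [map_sub, map_smul, sub_apply, smul_apply]
        module
      rw [this]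
      have h1 := (nem (fderiv ℝ A) hA' (crv (x, b))).norm_coe_le_norm τ
      calc _ ≤ ‖nem (fderiv ℝ A) hA' (crv (x, b)) τ‖ * ‖((0 : P), D t)‖ * ‖x‖ :=
            ContinuousLinearMap.le_opNorm₂ _ _ _
        _ ≤ ‖nem (fderiv ℝ A) hA' (crv (x, b))‖ * ‖D t‖ * ‖x‖ := by
            gcongr
            simp [Prod.norm_def]
        _ = _ := by ring)
  have h1 := hzero 1 (by simp)
  have hB1 := hBb 1
  have hG1 := hGg 1
  simp only [D, one_smul] at h1
  rw [← hG1, ← hB1]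
  exact sub_eq_zero.1 h1

theorem core [CompleteSpace P] (A : P × Q → P →L[ℝ] Q) (hA : ContDiff ℝ (⊤ : ℕ∞) A)
    (hint : ∀ᶠ z in 𝓝 (0 : P × Q), ∀ v w,
      fderiv ℝ A z (v, A z v) w = fderiv ℝ A z (w, A z w) v) :
    ∃ G : OpenPartialHomeomorph (P × Q) (P × Q), 0 ∈ G.source ∧ G 0 = 0 ∧
      ContDiffOn ℝ (⊤ : ℕ∞) G G.source ∧ ContDiffOn ℝ (⊤ : ℕ∞) G.symm G.target ∧
      ∀ z ∈ G.source, ∃ e : (P × Q) ≃L[ℝ] (P × Q), HasFDerivAt G (e : P × Q →L[ℝ] P × Q) z ∧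
        ∀ v, e (v, 0) = (v, A (G z) v) := by
  have hA' : Continuous (fderiv ℝ A) := hA.continuous_fderiv (by simp)
  have hA1 : ContDiff ℝ 1 A := hA.of_le (by exact_mod_cast le_top)
  let N := nem A hA.continuous
  have hN : ContDiff ℝ (⊤ : ℕ∞) N := nem_contDiff A hA
  have hNd : ∀ b, HasFDerivAt N (app (nem (fderiv ℝ A) hA' b)) b := fun b => nem_hasFDerivAt A hA1 b
  -- the nonlinear part
  let R : P × C(K, Q) → C(K, Q) := fun z => integ (app (N (crv z)) (cst z.1))
  have hR : ContDiff ℝ (⊤ : ℕ∞) R := by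
    have h1 : ContDiff ℝ (⊤ : ℕ∞) (fun z : P × C(K, Q) => app (N (crv z))) :=
      (app_contDiff _ (E := P) (F := Q)).comp (hN.comp (crv (E := P) (F := Q)).contDiff)
    have h2 : ContDiff ℝ (⊤ : ℕ∞) (fun z : P × C(K, Q) => cst z.1) :=
      (cst (E := P)).contDiff.comp contDiff_fst
    exact (integ (E := Q)).contDiff.comp (h1.clm_apply h2)
  have hRd : ∀ z, HasFDerivAt R (integ.comp
      ((app (N (crv z))).comp (cst.comp (ContinuousLinearMap.fst ℝ P C(K, Q))) +
       (app.flip (cst z.1)).comp ((app (nem (fderiv ℝ A) hA' (crv z))).comp crv))) z := by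
    intro z
    have h0 : HasFDerivAt (fun z : P × C(K, Q) => N (crv z)) _ z :=
      (hNd (crv z)).comp z (crv (E := P) (F := Q)).hasFDerivAt
    have h1 : HasFDerivAt (fun z : P × C(K, Q) => app (N (crv z))) _ z :=
      HasFDerivAt.comp (g := fun a : C(K, P →L[ℝ] Q) => app a)
        (f := fun z : P × C(K, Q) => N (crv z)) z (app_hasFDerivAt (N (crv z))) h0
    have h2 : HasFDerivAt (fun z : P × C(K, Q) => cst z.1) _ z :=
      (cst (E := P)).hasFDerivAt.comp z hasFDerivAt_fst
    have h3 := (integ (E := Q)).hasFDerivAt.comp z (h1.clm_apply h2)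
    refine h3.congr_fderiv ?_
    ext w <;> simp
  let H : P × C(K, Q) → P × C(K, Q) := fun z => (z.1, z.2 - R z)
  have hH : ContDiff ℝ (⊤ : ℕ∞) H := contDiff_fst.prodMk (contDiff_snd.sub hR)
  let T : P →L[ℝ] C(K, Q) := integ.comp ((app (N 0)).comp cst)
  let eH : (P × C(K, Q)) ≃L[ℝ] (P × C(K, Q)) :=
    (ContinuousLinearEquiv.refl ℝ P).skewProd (ContinuousLinearEquiv.refl ℝ C(K, Q)) (-T)
  have hHd : HasFDerivAt H (eH : P × C(K, Q) →L[ℝ] P × C(K, Q)) 0 := by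
    have := (hasFDerivAt_fst (𝕜 := ℝ) (p := (0 : P × C(K, Q)))).prodMk
      ((hasFDerivAt_snd (𝕜 := ℝ) (p := (0 : P × C(K, Q)))).sub (hRd 0))
    refine this.congr_fderiv ?_
    apply ContinuousLinearMap.ext
    rintro ⟨v, g⟩
    simp [eH, T]
    abel
  obtain ⟨Φ, hΦ0, -, hΦH, hΦs, -⟩ := inverse_fun H univ isOpen_univ 0 (mem_univ _)
    hH.contDiffOn eH hHd
  have hR0 : ∀ b, R (0, b) = 0 := by intro b; simp [R]
  have hH0 : H 0 = 0 := by
    have := hR0 0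
    simp only [H]
    rw [show (0 : P × C(K,Q)) = (0, 0) from rfl, this]
    simp
  have hΦt0 : (0 : P × C(K, Q)) ∈ Φ.target := by
    have := Φ.map_source hΦ0
    rwa [hΦH, hH0] at this
  have hΦs0 : Φ.symm 0 = 0 := by
    have := Φ.left_inv hΦ0
    rwa [hΦH, hH0] at this
  let ι : P × Q →L[ℝ] P × C(K, Q) := (ContinuousLinearMap.id ℝ P).prodMap cst
  have hι : ∀ z, ι z = (z.1, cst z.2) := fun z => rfl
  let β : P × Q → C(K, Q) := fun z => (Φ.symm (ι z)).2
  have hS : IsOpen (ι ⁻¹' Φ.target) := Φ.open_target.preimage ι.continuous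
  have hβ : ContDiffOn ℝ (⊤ : ℕ∞) β (ι ⁻¹' Φ.target) :=
    contDiff_snd.comp_contDiffOn (hΦs.comp ι.contDiff.contDiffOn (fun z hz => hz))
  have hβeq : ∀ z ∈ ι ⁻¹' Φ.target, β z = cst z.2 + R (z.1, β z) := by
    intro z hz
    have h := Φ.right_inv hz
    rw [hΦH, hι] at h
    have h1 : (Φ.symm (ι z)).1 = z.1 := congrArg Prod.fst h
    have h2 : (Φ.symm (ι z)).2 - R (Φ.symm (ι z)) = cst z.2 := congrArg Prod.snd h
    have h3 : (z.1, β z) = Φ.symm (ι z) := by rw [← h1]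
    rw [h3, ← h2]
    simp [β]
  obtain ⟨ε, hε, hball⟩ := Metric.eventually_nhds_iff_ball.1 hint
  have hcβ : ContinuousOn (fun z : P × Q => crv (z.1, β z)) (ι ⁻¹' Φ.target) :=
    (crv (E := P) (F := Q)).continuous.comp_continuousOn
      (continuous_fst.continuousOn.prodMk hβ.continuousOn)
  let S : Set (P × Q) := ι ⁻¹' Φ.target ∩ (fun z : P × Q => crv (z.1, β z)) ⁻¹' Metric.ball 0 ε
  have hSo : IsOpen S := hcβ.isOpen_inter_preimage hS Metric.isOpen_ball
  have hβ0 : β 0 = 0 := by simp [β, hΦs0]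
  have h0S : (0 : P × Q) ∈ S := by
    refine ⟨by simpa using hΦt0, ?_⟩
    simp only [mem_preimage, hβ0, Prod.fst_zero]
    rw [show ((0 : P), (0 : C(K,Q))) = 0 from rfl, map_zero]
    exact Metric.mem_ball_self hε
  let g : P × Q → P × Q := fun z => (z.1, ev1 (β z))
  have hβS : ContDiffOn ℝ (⊤ : ℕ∞) β S := hβ.mono inter_subset_left
  have hg : ContDiffOn ℝ (⊤ : ℕ∞) g S :=
    contDiff_fst.contDiffOn.prodMk ((ev1 (E := Q)).contDiff.comp_contDiffOn hβS)
  have hβd : ∀ z ∈ S, HasFDerivAt β (fderiv ℝ β z) z := fun z hz =>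
    ((hβS.contDiffAt (hSo.mem_nhds hz)).differentiableAt (by simp)).hasFDerivAt
  have hgd : ∀ z ∈ S, HasFDerivAt g
      ((ContinuousLinearMap.fst ℝ P Q).prod (ev1.comp (fderiv ℝ β z))) z := fun z hz =>
    hasFDerivAt_fst.prodMk ((ev1 (E := Q)).hasFDerivAt.comp z (hβd z hz))
  have hpde : ∀ z ∈ S, ∀ v, ev1 (fderiv ℝ β z (v, 0)) = A (g z) v := by
    intro z hz v
    have hd1 : HasFDerivAt (fun z : P × Q => cst z.2 + R (z.1, β z)) _ z :=
      ((cst (E := Q)).hasFDerivAt.comp z hasFDerivAt_snd).add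
      (HasFDerivAt.comp (g := R) (f := fun z : P × Q => (z.1, β z)) z (hRd (z.1, β z))
        (hasFDerivAt_fst.prodMk (hβd z hz)))
    have hd2 := (hβd z hz).congr_of_eventuallyEq
      (f₁ := fun z : P × Q => cst z.2 + R (z.1, β z))
      (by filter_upwards [hS.mem_nhds hz.1] with w hw using (hβeq w hw).symm)
    have hu := hd2.unique hd1
    have hu' := congrArg (fun L => L (v, (0:Q))) hu
    refine ode_step A hA hA' z.1 v z.2 (β z) (fderiv ℝ β z (v, 0)) (hβeq z hz.1) ?_ ?_
    · refine hu'.trans ?_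
      simp [N]
      abel
    · intro t
      apply hball
      rw [mem_ball_zero_iff]
      exact lt_of_le_of_lt ((crv (z.1, β z)).norm_coe_le_norm t) (mem_ball_zero_iff.1 hz.2)
  have hw : ∀ w, ev1 (fderiv ℝ β 0 (0, w)) = w := by
    intro w
    have h1 : HasFDerivAt (fun y : Q => β (0, y)) ((fderiv ℝ β 0).comp (ContinuousLinearMap.inr ℝ P Q)) 0 :=
      HasFDerivAt.comp (g := β) (f := fun y : Q => ((0:P), y)) 0 (hβd 0 h0S)
        (ContinuousLinearMap.inr ℝ P Q).hasFDerivAt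
    have h2 : HasFDerivAt (fun y : Q => β (0, y)) cst 0 := by
      refine (cst (E := Q)).hasFDerivAt.congr_of_eventuallyEq ?_
      have hc : Continuous (fun y : Q => ((0:P), y)) := by fun_prop
      filter_upwards [(hS.preimage hc).mem_nhds (show (0:Q) ∈ _ from h0S.1)] with y hy
      rw [hβeq _ hy, hR0, add_zero]
    have h3 := h1.unique h2
    have h4 := congrArg (fun L => L w) h3
    simp only [ContinuousLinearMap.comp_apply, ContinuousLinearMap.inr_apply] at h4
    rw [h4]; rfl
  have hg0 : g 0 = 0 := by simp [g, hβ0]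
  let eg : (P × Q) ≃L[ℝ] (P × Q) :=
    (ContinuousLinearEquiv.refl ℝ P).skewProd (ContinuousLinearEquiv.refl ℝ Q) (A 0)
  have hegd : HasFDerivAt g (eg : P × Q →L[ℝ] P × Q) 0 := by
    refine (hgd 0 h0S).congr_fderiv ?_
    apply ContinuousLinearMap.ext
    rintro ⟨v, w⟩
    have e1 : fderiv ℝ β 0 (v, w) = fderiv ℝ β 0 (v, 0) + fderiv ℝ β 0 (0, w) := by
      rw [← map_add]; simp
    have e2 := hpde 0 h0S v
    have e3 := hw w
    rw [hg0] at e2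
    simp only [ev1_apply] at e2 e3
    simp [eg, e1, e2, e3, add_comm]
  obtain ⟨G, hG0, hGS, hGg, hGs, hGd⟩ := inverse_fun g S hSo 0 h0S hg eg hegd
  refine ⟨G, hG0, by rw [hGg, hg0], by rw [hGg]; exact hg.mono hGS, hGs, ?_⟩
  intro z hz
  obtain ⟨e, he⟩ := hGd z hz
  refine ⟨e, by rwa [hGg], ?_⟩
  intro v
  have h1 := congrArg (fun L => L (v, (0:Q))) (he.unique (hgd z (hGS hz)))
  refine h1.trans ?_
  rw [hGg]
  simp only [ContinuousLinearMap.prod_apply, ContinuousLinearMap.comp_apply, hpde z (hGS hz) v]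
  rfl

end core

lemma coords {n k : ℕ} (D : Submodule ℝ (Fin n → ℝ)) (hD : Module.finrank ℝ D = k) :
    ∃ e : (Fin n → ℝ) ≃L[ℝ] (Fin k → ℝ) × (Fin (n - k) → ℝ), ∀ x, x ∈ D ↔ (e x).2 = 0 := by
  obtain ⟨W, hW⟩ := D.exists_isCompl
  have hW2 : Module.finrank ℝ W = n - k := by
    have := Submodule.finrank_add_eq_of_isCompl hW
    simp at this
    omega
  let e1 : D ≃ₗ[ℝ] (Fin k → ℝ) := LinearEquiv.ofFinrankEq _ _ (by simp [hD])
  let e2 : W ≃ₗ[ℝ] (Fin (n - k) → ℝ) := LinearEquiv.ofFinrankEq _ _ (by simp [hW2])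
  let e := (D.prodEquivOfIsCompl W hW).symm.trans (e1.prodCongr e2)
  refine ⟨e.toContinuousLinearEquiv, fun x => ?_⟩
  have : (e x).2 = e2 ((D.prodEquivOfIsCompl W hW).symm x).2 := rfl
  change _ ↔ (e x).2 = 0
  rw [this, LinearEquiv.map_eq_zero_iff, Submodule.prodEquivOfIsCompl_symm_apply_snd_eq_zero]

lemma coord_finrank {n k : ℕ} (hk : k ≤ n) : Module.finrank ℝ (Submodule.span ℝ
    {v : Fin n → ℝ | ∃ j : Fin n, (j : ℕ) < k ∧ v = Pi.single j (1 : ℝ)}) = k := by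
  have h1 : {v : Fin n → ℝ | ∃ j : Fin n, (j : ℕ) < k ∧ v = Pi.single j (1 : ℝ)}
      = range (fun i : Fin k => (Pi.single (Fin.castLE hk i) (1:ℝ) : Fin n → ℝ)) := by
    ext v
    constructor
    · rintro ⟨j, hj, rfl⟩
      exact ⟨⟨j, hj⟩, rfl⟩
    · rintro ⟨i, rfl⟩
      exact ⟨Fin.castLE hk i, i.2, rfl⟩
  rw [h1, finrank_span_eq_card]
  · simp
  · have := (Pi.basisFun ℝ (Fin n)).linearIndependent.comp _ (Fin.castLE_injective hk)
    convert this using 1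
    ext i
    simp

lemma cutoff {E F : Type} [NormedAddCommGroup E] [NormedSpace ℝ E] [FiniteDimensional ℝ E]
    [NormedAddCommGroup F] [NormedSpace ℝ F] (f : E → F) (U : Set E) (hU : IsOpen U) (h0 : 0 ∈ U)
    (hf : ContDiffOn ℝ (⊤ : ℕ∞) f U) :
    ∃ g : E → F, ContDiff ℝ (⊤ : ℕ∞) g ∧ g =ᶠ[𝓝 0] f := by
  obtain ⟨r, hr, hrU⟩ := Metric.isOpen_iff.1 hU 0 h0
  let χ : ContDiffBump (0 : E) := ⟨r / 4, r / 2, by positivity, by linarith⟩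
  refine ⟨fun x => χ x • f x, ?_, ?_⟩
  · rw [contDiff_iff_contDiffAt]
    intro x
    by_cases hx : x ∈ U
    · exact χ.contDiff.contDiffAt.smul (hf.contDiffAt (hU.mem_nhds hx))
    · have hx' : x ∈ (tsupport χ)ᶜ := by
        intro h
        rw [χ.tsupport_eq] at h
        exact hx (hrU (Metric.closedBall_subset_ball (by simp [χ]; linarith) h))
      have : (fun x => χ x • f x) =ᶠ[𝓝 x] fun _ => 0 := by
        filter_upwards [(isClosed_tsupport _).isOpen_compl.mem_nhds hx'] with y hy
        rw [image_eq_zero_of_notMem_tsupport hy, zero_smul]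
      exact contDiffAt_const.congr_of_eventuallyEq this
  · filter_upwards [χ.eventuallyEq_one] with x hx
    simp [hx]

/-- local graph form -/
lemma graph_form {n k : ℕ} (Δ : (Fin n → ℝ) → Submodule ℝ (Fin n → ℝ))
    (hdim : ∀ x, Module.finrank ℝ (Δ x) = k) (p : Fin n → ℝ) (U : Set (Fin n → ℝ))
    (hU : IsOpen U) (hp : p ∈ U) (V : Fin k → (Fin n → ℝ) → (Fin n → ℝ))
    (hV : ∀ i, ContDiffOn ℝ (⊤ : ℕ∞) (V i) U)
    (hspan : ∀ x ∈ U, Submodule.span ℝ (Set.range fun i => V i x) = Δ x) :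
    ∃ (e : (Fin n → ℝ) ≃L[ℝ] (Fin k → ℝ) × (Fin (n - k) → ℝ))
      (A : (Fin k → ℝ) × (Fin (n - k) → ℝ) → (Fin k → ℝ) →L[ℝ] (Fin (n - k) → ℝ))
      (O : Set ((Fin k → ℝ) × (Fin (n - k) → ℝ))),
      ContDiff ℝ (⊤ : ℕ∞) A ∧ IsOpen O ∧ 0 ∈ O ∧
      ∀ z ∈ O, ∀ w, w ∈ Δ (e.symm z + p) ↔ (e w).2 = A z (e w).1 := by
  obtain ⟨e, he⟩ := coords (Δ p) (hdim p)
  let T : (Fin n → ℝ) → (Fin k → ℝ) →L[ℝ] (Fin n → ℝ) := fun x =>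
    ∑ i, (ContinuousLinearMap.proj (R := ℝ) (φ := fun _ : Fin k => ℝ) i).smulRight (V i x)
  have hTa : ∀ x c, T x c = ∑ i, c i • V i x := by
    intro x c
    simp [T]
  have hT : ContDiffOn ℝ (⊤ : ℕ∞) T U := by
    apply ContDiffOn.sum
    intro i _
    exact (ContinuousLinearMap.smulRightL ℝ (Fin k → ℝ) (Fin n → ℝ)
      (ContinuousLinearMap.proj (R := ℝ) (φ := fun _ : Fin k => ℝ) i)).contDiff.comp_contDiffOn (hV i)
  have hmem : ∀ x ∈ U, ∀ w, w ∈ Δ x ↔ ∃ c, T x c = w := by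
    intro x hx w
    rw [← hspan x hx, Submodule.mem_span_range_iff_exists_fun]
    simp only [hTa]
  have hTinj : ∀ c, T p c = 0 → c = 0 := by
    have hli : LinearIndependent ℝ (fun i => V i p) := by
      rw [linearIndependent_iff_card_eq_finrank_span, Set.finrank, hspan p hp, hdim p]
      simp
    intro c hc
    rw [hTa] at hc
    funext i
    exact Fintype.linearIndependent_iff.1 hli c hc i
  let M : (Fin n → ℝ) → (Fin k → ℝ) →L[ℝ] (Fin k → ℝ) := fun x =>
    ((ContinuousLinearMap.fst ℝ (Fin k → ℝ) (Fin (n - k) → ℝ)).comp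
      (e : (Fin n → ℝ) →L[ℝ] (Fin k → ℝ) × (Fin (n - k) → ℝ))).comp (T x)
  let C : (Fin n → ℝ) → (Fin k → ℝ) →L[ℝ] (Fin (n - k) → ℝ) := fun x =>
    ((ContinuousLinearMap.snd ℝ (Fin k → ℝ) (Fin (n - k) → ℝ)).comp
      (e : (Fin n → ℝ) →L[ℝ] (Fin k → ℝ) × (Fin (n - k) → ℝ))).comp (T x)
  have hMa : ∀ x c, M x c = (e (T x c)).1 := fun x c => rfl
  have hCa : ∀ x c, C x c = (e (T x c)).2 := fun x c => rfl
  have hM : ContDiffOn ℝ (⊤ : ℕ∞) M U := contDiffOn_const.clm_comp hT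
  have hC : ContDiffOn ℝ (⊤ : ℕ∞) C U := contDiffOn_const.clm_comp hT
  have hMp : M p ∈ range ((↑) : ((Fin k → ℝ) ≃L[ℝ] (Fin k → ℝ)) → _) := by
    have hinj : Function.Injective (M p : (Fin k → ℝ) →ₗ[ℝ] (Fin k → ℝ)) := by
      rw [injective_iff_map_eq_zero]
      intro c hc
      apply hTinj
      have h2 : (e (T p c)).2 = 0 := (he _).1 ((hmem p hp _).2 ⟨c, rfl⟩)
      have h1 : (e (T p c)).1 = 0 := hc
      exact (map_eq_zero_iff e e.injective).1 (Prod.ext h1 h2)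
    refine ⟨(LinearEquiv.ofInjectiveEndo _ hinj).toContinuousLinearEquiv, ?_⟩
    ext c
    rfl
  let U' := U ∩ M ⁻¹' range ((↑) : ((Fin k → ℝ) ≃L[ℝ] (Fin k → ℝ)) → _)
  have hU' : IsOpen U' := hM.continuousOn.isOpen_inter_preimage hU ContinuousLinearEquiv.isOpen
  let B : (Fin n → ℝ) → (Fin k → ℝ) →L[ℝ] (Fin (n - k) → ℝ) := fun x =>
    (C x).comp (M x).inverse
  have hB : ContDiffOn ℝ (⊤ : ℕ∞) B U' := by
    refine (hC.mono inter_subset_left).clm_comp ?_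
    intro x hx
    obtain ⟨m, hm⟩ := hx.2
    have h1 : ContDiffAt ℝ (⊤ : ℕ∞) ContinuousLinearMap.inverse (M x) := by
      rw [← hm]; exact contDiffAt_map_inverse m
    exact h1.comp_contDiffWithinAt x ((hM.mono inter_subset_left) x hx)
  have hBm : ∀ x ∈ U', ∀ w, w ∈ Δ x ↔ (e w).2 = B x (e w).1 := by
    intro x hx w
    obtain ⟨m, hm⟩ := hx.2
    have hBa : ∀ c, B x c = C x (m.symm c) := by
      intro c
      simp only [B, ← hm, ContinuousLinearMap.inverse_equiv]
      rfl
    have hma : ∀ c, m c = (e (T x c)).1 := fun c => by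
      rw [← hMa, ← hm]; rfl
    rw [hmem x hx.1, hBa]
    constructor
    · rintro ⟨c, rfl⟩
      rw [← hma, m.symm_apply_apply, hCa]
    · intro h
      refine ⟨m.symm (e w).1, e.injective (Prod.ext ?_ ?_)⟩
      · rw [← hma, m.apply_symm_apply]
      · rw [h, hCa]
  have ha : ContDiff ℝ (⊤ : ℕ∞) (fun z => e.symm z + p) := e.symm.contDiff.add contDiff_const
  have haU : IsOpen ((fun z => e.symm z + p) ⁻¹' U') := hU'.preimage ha.continuous
  have h0 : (0 : (Fin k → ℝ) × (Fin (n - k) → ℝ)) ∈ ((fun z => e.symm z + p) ⁻¹' U') := by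
    simp only [mem_preimage, map_zero, zero_add]
    exact ⟨hp, hMp⟩
  obtain ⟨A, hA, hAB⟩ := cutoff (fun z => B (e.symm z + p)) _ haU h0
    (hB.comp ha.contDiffOn (fun z hz => hz))
  obtain ⟨O, hO, hOo, h0O⟩ := eventually_nhds_iff.1 (hAB.and (haU.mem_nhds h0))
  refine ⟨e, A, O, hA, hOo, h0O, fun z hz w => ?_⟩
  rw [(hO z hz).1]
  exact hBm _ (hO z hz).2 w

end Frob

/-- **Frobenius's theorem.** Let `Δ` assign to each point of `ℝⁿ` a `k`-dimensional
subspace, smoothly (locally spanned by smooth vector fields `V₁, …, V_k`). If `Δ` is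
involutive (closed under the Lie bracket of vector fields tangent to it on open sets),
then `Δ` is locally straightenable: near every point there is a smooth diffeomorphism
whose derivative maps `Δ` onto the coordinate subspace spanned by the first `k`
standard basis vectors. -/
theorem frobenius_theorem {n k : ℕ} (Δ : (Fin n → ℝ) → Submodule ℝ (Fin n → ℝ))
    (hdim : ∀ x, Module.finrank ℝ (Δ x) = k)
    (hsmooth : ∀ p : Fin n → ℝ, ∃ U : Set (Fin n → ℝ), IsOpen U ∧ p ∈ U ∧
      ∃ V : Fin k → (Fin n → ℝ) → (Fin n → ℝ),
        (∀ i, ContDiffOn ℝ (⊤ : ℕ∞) (V i) U) ∧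
        (∀ x ∈ U, Submodule.span ℝ (Set.range fun i => V i x) = Δ x))
    (hinv : ∀ (s : Set (Fin n → ℝ)), IsOpen s →
      ∀ X Y : (Fin n → ℝ) → (Fin n → ℝ),
        ContDiffOn ℝ (⊤ : ℕ∞) X s → ContDiffOn ℝ (⊤ : ℕ∞) Y s →
        (∀ x ∈ s, X x ∈ Δ x) → (∀ x ∈ s, Y x ∈ Δ x) →
        (∀ x ∈ s, VectorField.lieBracket ℝ X Y x ∈ Δ x)) :
    ∀ p : Fin n → ℝ, ∃ (U : Set (Fin n → ℝ)) (ψ ψinv : (Fin n → ℝ) → (Fin n → ℝ)),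
      IsOpen U ∧ p ∈ U ∧ IsOpen (ψ '' U) ∧
      Set.InjOn ψ U ∧
      ContDiffOn ℝ (⊤ : ℕ∞) ψ U ∧ ContDiffOn ℝ (⊤ : ℕ∞) ψinv (ψ '' U) ∧
      (∀ x ∈ U, ψinv (ψ x) = x) ∧
      (∀ q ∈ U, Submodule.map (fderiv ℝ ψ q : (Fin n → ℝ) →ₗ[ℝ] (Fin n → ℝ)) (Δ q) =
        Submodule.span ℝ
          {v : Fin n → ℝ | ∃ j : Fin n, (j : ℕ) < k ∧ v = Pi.single j (1 : ℝ)}) := by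
  intro p
  obtain ⟨U0, hU0, hpU0, V, hV, hspan⟩ := hsmooth p
  obtain ⟨e, A, O, hA, hO, h0O, hmem⟩ := Frob.graph_form Δ hdim p U0 hU0 hpU0 V hV hspan
  have hAd : Differentiable ℝ A := hA.differentiable (by simp)
  let c : (Fin n → ℝ) → (Fin k → ℝ) × (Fin (n - k) → ℝ) := fun x => e (x - p)
  have hc : ContDiff ℝ (⊤ : ℕ∞) c := e.contDiff.comp (contDiff_id.sub contDiff_const)
  have hcd : ∀ x, HasFDerivAt c (e : (Fin n → ℝ) →L[ℝ] _) x := by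
    intro x
    have h : HasFDerivAt c _ x := HasFDerivAt.comp (g := e) (f := fun x => x - p) x
      e.hasFDerivAt ((hasFDerivAt_id x).sub_const p)
    exact h
  have hcp : c p = 0 := by simp [c]
  have hca : ∀ x, e.symm (c x) + p = x := fun x => by simp [c]
  have hac : ∀ z, c (e.symm z + p) = z := fun z => by simp [c]
  have hint : ∀ z ∈ O, ∀ v w, fderiv ℝ A z (v, A z v) w = fderiv ℝ A z (w, A z w) v := by
    intro z hz v w
    let X : (Fin k → ℝ) → (Fin n → ℝ) → (Fin n → ℝ) := fun v x => e.symm (v, A (c x) v)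
    have hX : ∀ v, ContDiff ℝ (⊤ : ℕ∞) (X v) := fun v =>
      e.symm.contDiff.comp (contDiff_const.prodMk ((hA.comp hc).clm_apply contDiff_const))
    have hXm : ∀ v, ∀ x ∈ c ⁻¹' O, X v x ∈ Δ x := by
      intro v x hx
      have := (hmem (c x) hx (X v x))
      rw [hca] at this
      rw [this]
      simp [X]
    have hXd : ∀ v x u, fderiv ℝ (X v) x u = e.symm (0, fderiv ℝ A (c x) (e u) v) := by
      intro v x u
      have h1 : HasFDerivAt (fun x => A (c x)) _ x := (hAd (c x)).hasFDerivAt.comp x (hcd x)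
      have h2 := h1.clm_apply (hasFDerivAt_const v x)
      have h3 := e.symm.hasFDerivAt.comp x ((hasFDerivAt_const v x).prodMk h2)
      have h4 : fderiv ℝ (X v) x = _ := h3.fderiv
      rw [h4]
      simp
    have hx : e.symm z + p ∈ c ⁻¹' O := by rw [Set.mem_preimage, hac]; exact hz
    have h := hinv (c ⁻¹' O) (hO.preimage hc.continuous) (X v) (X w) (hX v).contDiffOn
      (hX w).contDiffOn (hXm v) (hXm w) _ hx
    rw [hmem z hz, VectorField.lieBracket, hXd, hXd, hac, ← map_sub, e.apply_symm_apply] at h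
    simp only [X, hac, e.apply_symm_apply, Prod.mk_sub_mk, sub_self, map_zero] at h
    exact sub_eq_zero.1 h
  obtain ⟨G, hG0, hG00, hGc, hGs, hGd⟩ := Frob.core A hA
    (Filter.eventually_of_mem (hO.mem_nhds h0O) hint)
  have hk : k ≤ n := by
    have := Submodule.finrank_le (Δ p)
    rw [hdim p] at this
    simpa using this
  obtain ⟨κ, hκ⟩ := Frob.coords _ (Frob.coord_finrank hk)
  let U : Set (Fin n → ℝ) := c ⁻¹' (O ∩ G.target)
  have himg : (fun x => κ.symm (G.symm (c x))) '' U = κ ⁻¹' (G.source ∩ G ⁻¹' O) := by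
    ext y
    constructor
    · rintro ⟨x, hx, rfl⟩
      simp only [Set.mem_preimage, κ.apply_symm_apply, Set.mem_inter_iff]
      refine ⟨G.map_target hx.2, ?_⟩
      rw [G.right_inv hx.2]
      exact hx.1
    · rintro ⟨h1, h2⟩
      refine ⟨e.symm (G (κ y)) + p, ⟨?_, ?_⟩, ?_⟩
      · rw [hac]; exact h2
      · rw [hac]; exact G.map_source h1
      · simp only [hac, G.left_inv h1, κ.symm_apply_apply]
  have hinvl : ∀ x ∈ U, e.symm (G (κ (κ.symm (G.symm (c x))))) + p = x := by
    intro x hx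
    rw [κ.apply_symm_apply, G.right_inv hx.2, hca]
  refine ⟨U, fun x => κ.symm (G.symm (c x)), fun y => e.symm (G (κ y)) + p,
    (hO.inter G.open_target).preimage hc.continuous, ?_, ?_, ?_, ?_, ?_, hinvl, ?_⟩
  · refine ⟨by rw [hcp]; exact h0O, ?_⟩
    rw [hcp, ← hG00]
    exact G.map_source hG0
  · rw [himg]
    exact (G.isOpen_inter_preimage hO).preimage κ.continuous
  · intro x hx y hy hxy
    rw [← hinvl x hx, ← hinvl y hy]
    simp only at hxy
    rw [hxy]
  · exact κ.symm.contDiff.comp_contDiffOn (hGs.comp hc.contDiffOn (fun x hx => hx.2))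
  · rw [himg]
    exact (e.symm.contDiff.comp_contDiffOn
      (hGc.comp κ.contDiff.contDiffOn (fun x hx => hx.1))).add contDiffOn_const
  · intro q hq
    obtain ⟨e', he', hv⟩ := hGd _ (G.map_target hq.2)
    have h1 : HasFDerivAt G.symm (e'.symm : _ →L[ℝ] _) (c q) := G.hasFDerivAt_symm hq.2 he'
    have h2 : HasFDerivAt (fun x => κ.symm (G.symm (c x))) _ q :=
      κ.symm.hasFDerivAt.comp q (h1.comp q (hcd q))
    rw [G.right_inv hq.2] at hv
    rw [h2.fderiv]
    have hm : ∀ w, w ∈ Δ q ↔ (e w).2 = A (c q) (e w).1 := by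
      intro w
      have := hmem (c q) hq.1 w
      rwa [hca] at this
    ext y
    rw [hκ, Submodule.mem_map]
    constructor
    · rintro ⟨w, hw, rfl⟩
      have h3 : e w = e' ((e w).1, 0) := by
        rw [hv, ← (hm w).1 hw]
      have h4 : e'.symm (e w) = ((e w).1, 0) := by
        rw [h3, e'.symm_apply_apply, ← h3]
      change (κ (κ.symm (e'.symm (e w)))).2 = 0
      rw [κ.apply_symm_apply, h4]
    · intro hy
      have hy' : κ y = ((κ y).1, 0) := Prod.ext rfl hy
      refine ⟨e.symm (e' (κ y)), ?_, ?_⟩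
      · rw [hm, e.apply_symm_apply, hy', hv]
      · change κ.symm (e'.symm (e (e.symm (e' (κ y))))) = y
        simp
end

section
/- Let X, Y : ℝ^n → ℝ^n be smooth (C^∞) vector fields and let φ be a global flow of X. Then for every p ∈ ℝ^n, the push-forward of Y under the time-(-t) flow map, evaluated at p, is differentiable in t at t = 0 with derivative equal to the Lie bracket: the function t ↦ D(φ(-t, ·))(φ(t,p)) · Y(φ(t,p)) has derivative [X,Y](p) at t = 0. -/
open Set Metric Filter Topology
open scoped NNReal

namespace FlowAux

variable {E : Type*} [NormedAddCommGroup E] [NormedSpace ℝ E]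

structure Good (Z : E → E) (p : E) (K : ℝ≥0) : Prop where
  one_le : (1 : ℝ) ≤ K
  diff : Differentiable ℝ Z
  bd : ∀ z ∈ closedBall p 1, ‖Z z‖ ≤ K
  lip : LipschitzOnWith K Z (closedBall p 1)
  dbd : ∀ z ∈ closedBall p 1, ‖fderiv ℝ Z z‖ ≤ K
  dlip : LipschitzOnWith K (fderiv ℝ Z) (closedBall p 1)
  dcont : Continuous (fderiv ℝ Z)

lemma exists_good [FiniteDimensional ℝ E] (Z : E → E) (hZ : ContDiff ℝ (⊤ : ℕ∞) Z) (p : E) :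
    ∃ K : ℝ≥0, Good Z p K := by
  have : ProperSpace E := FiniteDimensional.proper ℝ E
  have hc : IsCompact (closedBall p (1 : ℝ)) := isCompact_closedBall p 1
  have hv : Convex ℝ (closedBall p (1 : ℝ)) := convex_closedBall p 1
  have hD : ContDiff ℝ (⊤ : ℕ∞) (fderiv ℝ Z) := hZ.fderiv_right (by simp)
  obtain ⟨K1, h1⟩ := hZ.contDiffOn.exists_lipschitzOnWith (by simp) hv hc
  obtain ⟨K2, h2⟩ := hD.contDiffOn.exists_lipschitzOnWith (by simp) hv hc
  obtain ⟨C1, h3⟩ := hc.exists_bound_of_continuousOn hZ.continuous.continuousOn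
  obtain ⟨C2, h4⟩ := hc.exists_bound_of_continuousOn hD.continuous.continuousOn
  refine ⟨1 + K1 + K2 + C1.toNNReal + C2.toNNReal, ?_, hZ.differentiable (by simp), ?_, ?_, ?_, ?_,
    hD.continuous⟩
  · push_cast
    have := K1.2; have := K2.2
    have : 0 ≤ max C1 0 := le_max_right _ _
    have : 0 ≤ max C2 0 := le_max_right _ _
    simp only [NNReal.val_eq_coe] at *
    simp only [Real.coe_toNNReal']
    linarith
  · intro z hz
    refine (h3 z hz).trans ((Real.le_coe_toNNReal C1).trans ?_)
    norm_cast
    exact (le_add_of_nonneg_left (zero_le)).trans (le_add_of_nonneg_right (zero_le))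
  · refine h1.weaken ?_
    calc K1 ≤ K1 + (1 + K2 + C1.toNNReal + C2.toNNReal) := le_add_of_nonneg_right (zero_le)
      _ = _ := by ring
  · intro z hz
    refine (h4 z hz).trans ((Real.le_coe_toNNReal C2).trans ?_)
    norm_cast
    exact (le_add_of_nonneg_left (zero_le))
  · refine h2.weaken ?_
    calc K2 ≤ K2 + (1 + K1 + C1.toNNReal + C2.toNNReal) := le_add_of_nonneg_right (zero_le)
      _ = _ := by ring

section
variable {Z : E → E} {p : E} {K : ℝ≥0} (hg : Good Z p K) {ψ : ℝ → E → E}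
    (h0 : ∀ p, ψ 0 p = p) (hψ : ∀ t p, HasDerivAt (fun s => ψ s p) (Z (ψ t p)) t)

include hg h0 hψ

lemma stay {x : E} {T : ℝ} (hT : ‖x - p‖ + 2 * K * T ≤ 1) :
    ∀ s ∈ Icc 0 T, ‖ψ s x - p‖ ≤ ‖x - p‖ + 2 * K * s := by
  have hK := hg.one_le
  have hd : ∀ s, HasDerivAt (fun s => ψ s x - p) (Z (ψ s x)) s := fun s => (hψ s x).sub_const p
  refine image_norm_le_of_norm_deriv_right_lt_deriv_boundary (B' := fun _ => 2 * K)
    (fun s _ => (hd s).continuousAt.continuousWithinAt) (fun s _ => (hd s).hasDerivWithinAt)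
    (by simp [h0]) (fun s => ?_) ?_
  · simpa using ((hasDerivAt_id s).const_mul (2 * (K : ℝ))).const_add ‖x - p‖
  · intro s hs he
    have : ‖Z (ψ s x)‖ ≤ K := by
      apply hg.bd
      rw [mem_closedBall_iff_norm, he]
      have : 2 * (K : ℝ) * s ≤ 2 * K * T := by gcongr; exact hs.2.le
      linarith
    linarith

lemma exists_lin [CompleteSpace E] {x : E} (hx : ‖x - p‖ < 1 / 2) {T : ℝ} (hT0 : 0 ≤ T) (hT : 8 * K * T = 1) :
    ∃ V : ℝ → (E →L[ℝ] E), V 0 = ContinuousLinearMap.id ℝ E ∧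
      (∀ t ∈ Icc 0 T, HasDerivWithinAt V ((fderiv ℝ Z (ψ t x)).comp (V t)) (Icc 0 T) t) ∧
      (∀ t ∈ Icc 0 T, ‖V t - ContinuousLinearMap.id ℝ E‖ ≤ 3 * K * t) := by
  have hK := hg.one_le
  have hst : ∀ s ∈ Icc 0 T, ψ s x ∈ closedBall p 1 := by
    intro s hs
    rw [mem_closedBall_iff_norm]
    have := stay hg h0 hψ (x := x) (T := T) (by linarith) s hs
    have : 2 * (K : ℝ) * s ≤ 2 * K * T := by gcongr; exact hs.2
    linarith
  have hid : ‖ContinuousLinearMap.id ℝ E‖ ≤ 1 := ContinuousLinearMap.norm_id_le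
  have hA : ∀ s ∈ Icc 0 T, ∀ W : E →L[ℝ] E, ‖W - ContinuousLinearMap.id ℝ E‖ ≤ 1 →
      ‖(fderiv ℝ Z (ψ s x)).comp W‖ ≤ 2 * K := by
    intro s hs W hW
    have h1 : ‖W‖ ≤ 2 := by
      have := norm_le_norm_add_norm_sub (ContinuousLinearMap.id ℝ E) W
      rw [norm_sub_rev] at this
      linarith
    calc _ ≤ ‖fderiv ℝ Z (ψ s x)‖ * ‖W‖ := ContinuousLinearMap.opNorm_comp_le _ _
      _ ≤ K * 2 := by gcongr; exact hg.dbd _ (hst s hs)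
      _ = _ := by ring
  have hP : IsPicardLindelof (fun t (W : E →L[ℝ] E) => (fderiv ℝ Z (ψ t x)).comp W)
      (⟨0, left_mem_Icc.2 hT0⟩ : Icc 0 T) (ContinuousLinearMap.id ℝ E) 1 0 (2 * K) K := by
    refine ⟨?_, ?_, ?_, ?_⟩
    · intro t ht
      refine LipschitzOnWith.of_dist_le_mul fun W _ W' _ => ?_
      rw [dist_eq_norm, dist_eq_norm, ← ContinuousLinearMap.comp_sub]
      refine (ContinuousLinearMap.opNorm_comp_le _ _).trans ?_
      gcongr
      exact hg.dbd _ (hst t ht)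
    · intro W _
      have hc : Continuous (fun t => ψ t x) :=
        continuous_iff_continuousAt.2 fun t => (hψ t x).continuousAt
      exact ((hg.dcont.comp hc).clm_comp continuous_const).continuousOn
    · intro t ht W hW
      have := hA t ht W (by simpa [dist_eq_norm] using hW)
      simpa using this
    · simp only [NNReal.coe_mul, sub_zero, zero_sub]
      rw [max_eq_left (by simpa using hT0)]
      simp
      linarith
  obtain ⟨V, hV0, hV⟩ := hP.exists_eq_forall_mem_Icc_hasDerivWithinAt₀
  refine ⟨V, hV0, hV, ?_⟩
  have hd : ∀ t ∈ Icc 0 T, HasDerivWithinAt (fun t => V t - ContinuousLinearMap.id ℝ E)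
    ((fderiv ℝ Z (ψ t x)).comp (V t)) (Icc 0 T) t := fun t ht => (hV t ht).sub_const _
  refine image_norm_le_of_norm_deriv_right_lt_deriv_boundary (B' := fun _ => 3 * K)
    (fun s hs => (hd s hs).continuousWithinAt)
    (fun s hs => (hd s (Ico_subset_Icc_self hs)).mono_of_mem_nhdsWithin (Icc_mem_nhdsGE_of_mem hs))
    (by simp at hV0; simp [hV0]) (fun s => ?_) ?_
  · simpa using ((hasDerivAt_id s).const_mul (3 * (K : ℝ)))
  · intro s hs he
    have := hA s (Ico_subset_Icc_self hs) (V s) (by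
      rw [he]
      have : 3 * (K : ℝ) * s ≤ 3 * K * T := by gcongr; exact hs.2.le
      linarith)
    linarith

lemma key [CompleteSpace E] {x : E} (hx : ‖x - p‖ < 1 / 2) {T : ℝ} (hT0 : 0 ≤ T) (hT : 8 * K * T = 1)
    {s : ℝ} (hs : s ∈ Icc 0 T) :
    ∃ V : E →L[ℝ] E, HasFDerivAt (ψ s) V x ∧
      ‖V - ContinuousLinearMap.id ℝ E - s • fderiv ℝ Z p‖ ≤
        (2 * K + 7 * K ^ 2) * (‖x - p‖ + s) * s := by
  have hK := hg.one_le
  have hst : ∀ y, ‖y - p‖ < 1 / 2 → ∀ s ∈ Icc 0 T, ψ s y ∈ closedBall p 1 := by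
    intro y hy s hs
    rw [mem_closedBall_iff_norm]
    have := stay hg h0 hψ (x := y) (T := T) (by linarith) s hs
    have : 2 * (K : ℝ) * s ≤ 2 * K * T := by gcongr; exact hs.2
    linarith
  have hid : ‖ContinuousLinearMap.id ℝ E‖ ≤ 1 := ContinuousLinearMap.norm_id_le
  obtain ⟨V, hV0, hV, hVb⟩ := exists_lin hg h0 hψ hx hT0 hT
  have hVr : ∀ t ∈ Ico 0 T, HasDerivWithinAt V ((fderiv ℝ Z (ψ t x)).comp (V t)) (Ici t) t :=
    fun t ht => (hV t (Ico_subset_Icc_self ht)).mono_of_mem_nhdsWithin (Icc_mem_nhdsGE_of_mem ht)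
  refine ⟨V s, ?_, ?_⟩
  · set G := Real.exp (K * T) with hG
    have hG1 : 1 ≤ G := Real.one_le_exp (by positivity)
    have hev : ∀ᶠ y in 𝓝 x, ‖y - p‖ < 1 / 2 :=
      (by fun_prop : Continuous fun y => ‖y - p‖).continuousAt.eventually_lt_const hx
    have hO : (fun y => ψ s y - ψ s x - V s (y - x)) =O[𝓝 x] fun y => ‖y - x‖ ^ 2 := by
      refine Asymptotics.IsBigO.of_bound (G ^ 3) ?_
      filter_upwards [hev] with y hy
      have hdel : ∀ t ∈ Icc 0 T, ‖ψ t y - ψ t x‖ ≤ G * ‖y - x‖ := by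
        intro t ht
        have := dist_le_of_trajectories_ODE_of_mem (a := 0) (b := T) (v := fun _ => Z) (K := K)
          (s := fun _ => closedBall p 1) (f := fun t => ψ t y) (g := fun t => ψ t x)
          (δ := ‖y - x‖) (fun _ _ => hg.lip)
          (fun t _ => (hψ t y).continuousAt.continuousWithinAt)
          (fun t _ => (hψ t y).hasDerivWithinAt)
          (fun t ht => hst y hy t (Ico_subset_Icc_self ht))
          (fun t _ => (hψ t x).continuousAt.continuousWithinAt)
          (fun t _ => (hψ t x).hasDerivWithinAt)
          (fun t ht => hst x hx t (Ico_subset_Icc_self ht)) (by simp [h0, dist_eq_norm]) t ht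
        rw [dist_eq_norm] at this
        refine this.trans ?_
        rw [mul_comm, sub_zero, hG]
        gcongr
        exact ht.2
      have hgr := norm_le_gronwallBound_of_norm_deriv_right_le (a := 0) (b := T)
        (f := fun t => ψ t y - ψ t x - V t (y - x))
        (f' := fun t => Z (ψ t y) - Z (ψ t x) - ((fderiv ℝ Z (ψ t x)).comp (V t)) (y - x))
        (δ := 0) (K := K) (ε := K * (G * ‖y - x‖) ^ 2)
        (by
          intro t ht
          exact (((hψ t y).continuousAt.sub (hψ t x).continuousAt).continuousWithinAt).sub
            ((hV t ht).continuousWithinAt.clm_apply continuousWithinAt_const))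
        (by
          intro t ht
          exact (((hψ t y).sub (hψ t x)).hasDerivWithinAt).sub
            (by simpa using (hVr t ht).clm_apply (hasDerivWithinAt_const t (Ici t) (y - x))))
        (by simp [h0, hV0])
        (by
          intro t ht
          have ht' := Ico_subset_Icc_self ht
          have hb : ‖Z (ψ t y) - Z (ψ t x) - fderiv ℝ Z (ψ t x) (ψ t y - ψ t x)‖
              ≤ K * ‖ψ t y - ψ t x‖ * ‖ψ t y - ψ t x‖ := by
            refine Convex.norm_image_sub_le_of_norm_fderiv_le' (𝕜 := ℝ)
              (s := segment ℝ (ψ t x) (ψ t y)) (fun z _ => hg.diff z) ?_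
              (convex_segment _ _) (left_mem_segment _ _ _) (right_mem_segment _ _ _)
            intro z hz
            have hzB : z ∈ closedBall p 1 :=
              (convex_closedBall p 1).segment_subset (hst x hx t ht') (hst y hy t ht') hz
            have h1 := hg.dlip.dist_le_mul z hzB _ (hst x hx t ht')
            rw [dist_eq_norm, dist_eq_norm] at h1
            refine h1.trans ?_
            gcongr
            rw [norm_sub_rev, norm_sub_rev (ψ t y)]
            have := norm_sub_le_of_mem_segment hz
            simpa [norm_sub_rev] using this
          have heq : Z (ψ t y) - Z (ψ t x) - ((fderiv ℝ Z (ψ t x)).comp (V t)) (y - x)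
            = (Z (ψ t y) - Z (ψ t x) - fderiv ℝ Z (ψ t x) (ψ t y - ψ t x))
              + fderiv ℝ Z (ψ t x) (ψ t y - ψ t x - V t (y - x)) := by
            rw [map_sub _ (ψ t y - ψ t x) (V t (y - x)), ContinuousLinearMap.comp_apply]
            abel
          rw [heq, add_comm]
          refine (norm_add_le _ _).trans (add_le_add ?_ ?_)
          · refine (ContinuousLinearMap.le_opNorm _ _).trans ?_
            gcongr
            exact hg.dbd _ (hst x hx t ht')
          · refine hb.trans ?_
            rw [mul_assoc, ← sq]
            gcongr
            exact hdel t ht')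
        s hs
      have hKne : (K : ℝ) ≠ 0 := by positivity
      rw [gronwallBound_of_K_ne_0 hKne] at hgr
      refine hgr.trans ?_
      beta_reduce
      have hGs : Real.exp (K * (s - 0)) - 1 ≤ G := by
        have : Real.exp (K * (s - 0)) ≤ G := by
          rw [sub_zero, hG]; gcongr; exact hs.2
        linarith
      rw [mul_div_cancel_left₀ _ hKne, zero_mul, zero_add, norm_pow, norm_norm]
      calc _ ≤ (G * ‖y - x‖) ^ 2 * G := by gcongr
        _ = _ := by ring
    have h1 : HasFDerivAt (fun y => ψ s y - ψ s x - V s (y - x)) (0 : E →L[ℝ] E) x :=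
      hO.hasFDerivAt (by norm_num)
    have h2 : HasFDerivAt (fun y => ψ s x + V s (y - x)) (V s) x := by
      simpa using ((V s).hasFDerivAt (x := x)).sub_const (V s x) |>.const_add (ψ s x)
    have h3 := h1.add h2
    rw [zero_add] at h3
    refine h3.congr_of_eventuallyEq (Eventually.of_forall fun y => ?_)
    simp
  · have hsub : Icc 0 s ⊆ Icc 0 T := Icc_subset_Icc_right hs.2
    have := norm_image_sub_le_of_norm_deriv_le_segment' (a := 0) (b := s)
      (f := fun t => V t - ContinuousLinearMap.id ℝ E - t • fderiv ℝ Z p)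
      (f' := fun t => (fderiv ℝ Z (ψ t x)).comp (V t) - fderiv ℝ Z p)
      (C := (2 * K + 7 * K ^ 2) * (‖x - p‖ + s))
      (by
        intro t ht
        have h1 := ((hV t (hsub ht)).mono hsub).sub_const (ContinuousLinearMap.id ℝ E)
        have h2 := ((hasDerivAt_id t).smul_const (fderiv ℝ Z p)).hasDerivWithinAt (s := Icc 0 s)
        rw [one_smul] at h2
        exact h1.sub h2)
      (by
        intro t ht
        have htT := hsub (Ico_subset_Icc_self ht)
        have hW := hVb t htT
        have ht0 := ht.1
        have hts := ht.2.le
        have h3T : 3 * (K : ℝ) * t ≤ 3 * K * T := by gcongr; exact htT.2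
        have hV2 : ‖V t‖ ≤ 2 := by
          have := norm_le_norm_add_norm_sub (ContinuousLinearMap.id ℝ E) (V t)
          rw [norm_sub_rev] at this
          linarith
        have hpB : p ∈ closedBall p (1 : ℝ) := mem_closedBall_self zero_le_one
        have hA : ‖fderiv ℝ Z (ψ t x) - fderiv ℝ Z p‖ ≤ K * (‖x - p‖ + 2 * K * t) := by
          have h1 := hg.dlip.dist_le_mul _ (hst x hx t htT) _ hpB
          rw [dist_eq_norm, dist_eq_norm] at h1
          refine h1.trans ?_
          gcongr
          exact stay hg h0 hψ (x := x) (T := T) (by linarith) t htT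
        have heq : (fderiv ℝ Z (ψ t x)).comp (V t) - fderiv ℝ Z p =
          (fderiv ℝ Z (ψ t x) - fderiv ℝ Z p).comp (V t) +
            (fderiv ℝ Z p).comp (V t - ContinuousLinearMap.id ℝ E) := by
          ext v; simp
        rw [heq]
        calc _ ≤ ‖(fderiv ℝ Z (ψ t x) - fderiv ℝ Z p)‖ * ‖V t‖ +
              ‖fderiv ℝ Z p‖ * ‖V t - ContinuousLinearMap.id ℝ E‖ :=
              (norm_add_le _ _).trans (add_le_add (ContinuousLinearMap.opNorm_comp_le _ _)
                (ContinuousLinearMap.opNorm_comp_le _ _))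
          _ ≤ (K * (‖x - p‖ + 2 * K * t)) * 2 + K * (3 * K * t) := by
              gcongr
              exact hg.dbd _ hpB
          _ ≤ (K * (‖x - p‖ + 2 * K * s)) * 2 + K * (3 * K * s) := by gcongr
          _ ≤ _ := by
              have : 0 ≤ ‖x - p‖ := norm_nonneg _
              have hs0 := hs.1
              have e1 : 0 ≤ (K : ℝ) * s := by positivity
              have e2 : 0 ≤ (K : ℝ) ^ 2 * ‖x - p‖ := by positivity
              nlinarith)
      s (right_mem_Icc.2 hs.1)
    simpa [hV0] using this

end

/-- One-sided estimate along the reverse flow. -/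
lemma oneside [FiniteDimensional ℝ E] (X : E → E) (hX : ContDiff ℝ (⊤ : ℕ∞) X)
    (φ : ℝ → E → E) (h0 : ∀ p, φ 0 p = p)
    (hφ : ∀ t p, HasDerivAt (fun s => φ s p) (X (φ t p)) t) (p : E) :
    ∃ C : ℝ, ∃ T > 0, ∀ t ∈ Icc 0 T,
      ‖fderiv ℝ (fun x => φ (-t) x) (φ t p) - ContinuousLinearMap.id ℝ E + t • fderiv ℝ X p‖
        ≤ C * t ^ 2 := by
  have : CompleteSpace E := FiniteDimensional.complete ℝ E
  obtain ⟨K, hg⟩ := exists_good X hX p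
  obtain ⟨K', hg'⟩ := exists_good (fun x => - X x) hX.neg p
  have hK := hg.one_le
  have hK' := hg'.one_le
  have hψ : ∀ t p, HasDerivAt (fun s => φ (-s) p) (-X (φ (-t) p)) t := by
    intro t p
    have := (hφ (-t) p).scomp t (hasDerivAt_neg t)
    simpa [Function.comp_def] using this
  refine ⟨(2 * K' + 7 * K' ^ 2) * (2 * K + 1), min (1 / (8 * K)) (1 / (8 * K')), by positivity, ?_⟩
  intro t ht
  have ht1 : t ≤ 1 / (8 * K) := ht.2.trans (min_le_left _ _)
  have ht2 : t ≤ 1 / (8 * K') := ht.2.trans (min_le_right _ _)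
  have hKt : 8 * K * t ≤ 1 := by
    rw [le_div_iff₀ (by positivity)] at ht1; linarith
  have hx := stay hg h0 hφ (x := p) (T := t) (by simp; linarith) t (right_mem_Icc.2 ht.1)
  rw [sub_self, norm_zero, zero_add] at hx
  obtain ⟨V, hV, hVb⟩ := key hg' (ψ := fun t x => φ (-t) x) (by simpa using h0) hψ
    (x := φ t p) (T := 1 / (8 * K')) (by linarith) (by positivity) (by field_simp) (s := t)
    ⟨ht.1, ht2⟩
  have e1 : fderiv ℝ (fun x => φ (-t) x) (φ t p) = V := hV.fderiv
  have e2 : fderiv ℝ (fun x => - X x) p = - fderiv ℝ X p := fderiv_fun_neg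
  rw [e2, smul_neg, sub_neg_eq_add] at hVb
  rw [e1]
  refine hVb.trans ?_
  have := ht.1
  calc _ ≤ (2 * (K' : ℝ) + 7 * K' ^ 2) * (2 * K * t + t) * t := by gcongr
    _ = _ := by ring

lemma deriv_flow [FiniteDimensional ℝ E] (X : E → E) (hX : ContDiff ℝ (⊤ : ℕ∞) X)
    (φ : ℝ → E → E) (h0 : ∀ p, φ 0 p = p)
    (hφ : ∀ t p, HasDerivAt (fun s => φ s p) (X (φ t p)) t) (p : E) :
    HasDerivAt (fun t => fderiv ℝ (fun x => φ (-t) x) (φ t p)) (-fderiv ℝ X p) 0 := by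
  have hψ : ∀ t p, HasDerivAt (fun s => φ (-s) p) (-X (φ (-t) p)) t := by
    intro t p
    have := (hφ (-t) p).scomp t (hasDerivAt_neg t)
    simpa [Function.comp_def] using this
  obtain ⟨C, T, hT, h⟩ := oneside X hX φ h0 hφ p
  obtain ⟨C', T', hT', h'⟩ := oneside (fun x => - X x) hX.neg (fun t x => φ (-t) x)
    (by simpa using h0) hψ p
  have e2 : fderiv ℝ (fun x => - X x) p = - fderiv ℝ X p := fderiv_fun_neg
  simp only [neg_neg, e2] at h'
  have hO : (fun t : ℝ => fderiv ℝ (fun x => φ (-t) x) (φ t p) - ContinuousLinearMap.id ℝ E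
      + t • fderiv ℝ X p) =O[𝓝 0] fun t => ‖t - 0‖ ^ 2 := by
    refine Asymptotics.IsBigO.of_bound (max C C') ?_
    filter_upwards [Ioo_mem_nhds (neg_lt_zero.2 (lt_min hT hT')) (lt_min hT hT')] with t ht
    simp only [sub_zero, norm_pow, norm_norm, Real.norm_eq_abs, sq_abs, abs_abs]
    rcases le_total 0 t with h1 | h1
    · refine (h t ⟨h1, ht.2.le.trans (min_le_left _ _)⟩).trans ?_
      gcongr; exact le_max_left _ _
    · have := h' (-t) ⟨by linarith, by linarith [ht.1, min_le_right T T']⟩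
      simp only [neg_neg, smul_neg, neg_smul, neg_sq] at this
      refine this.trans ?_
      gcongr; exact le_max_right _ _
  have h1 : HasDerivAt (fun t : ℝ => fderiv ℝ (fun x => φ (-t) x) (φ t p)
      - ContinuousLinearMap.id ℝ E + t • fderiv ℝ X p) 0 0 := by
    have := (hO.hasFDerivAt (by norm_num)).hasDerivAt
    simpa using this
  have h2 := h1.add ((hasDerivAt_id (0 : ℝ)).smul_const (-fderiv ℝ X p))
  have h3 := h2.add_const (ContinuousLinearMap.id ℝ E)
  rw [zero_add, one_smul] at h3
  refine h3.congr_of_eventuallyEq (Eventually.of_forall fun y => ?_)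
  simp

end FlowAux


/-- The Lie bracket `[X,Y]` is the derivative at `t = 0` of the push-forward of `Y`
under the time-`(-t)` flow map of `X`:
`t ↦ D(φ(-t,·))(φ(t,p)) · Y(φ(t,p))` has derivative `[X,Y](p)` at `t = 0`. -/
theorem hasDerivAt_pushforward_lieBracket {n : ℕ}
    (X Y : (Fin n → ℝ) → (Fin n → ℝ))
    (hX : ContDiff ℝ (⊤ : ℕ∞) X) (hY : ContDiff ℝ (⊤ : ℕ∞) Y)
    (φ : ℝ → (Fin n → ℝ) → (Fin n → ℝ))
    (hφ0 : ∀ p, φ 0 p = p)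
    (hφ : ∀ t p, HasDerivAt (fun s => φ s p) (X (φ t p)) t)
    (p : Fin n → ℝ) :
    HasDerivAt (fun t : ℝ => fderiv ℝ (fun x => φ (-t) x) (φ t p) (Y (φ t p)))
      (VectorField.lieBracket ℝ X Y p) 0 := by
  have h1 := FlowAux.deriv_flow X hX φ hφ0 hφ p
  have hYd : HasFDerivAt Y (fderiv ℝ Y (φ 0 p)) (φ 0 p) :=
    (hY.differentiable (by simp) _).hasFDerivAt
  have h2 := hYd.comp_hasDerivAt (0 : ℝ) (hφ 0 p)
  have h3 := h1.clm_apply h2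
  have e : fderiv ℝ (fun x => φ (-0) x) (φ 0 p) = ContinuousLinearMap.id ℝ _ := by
    have : (fun x => φ (-0) x) = fun x => x := by funext x; simp [hφ0]
    rw [this]; exact fderiv_fun_id
  rw [e] at h3
  have e3 : VectorField.lieBracket ℝ X Y p = (-fderiv ℝ X p) ((Y ∘ fun s => φ s p) 0) +
      (ContinuousLinearMap.id ℝ (Fin n → ℝ)) ((fderiv ℝ Y (φ 0 p)) (X (φ 0 p))) := by
    simp only [VectorField.lieBracket_eq, hφ0, Function.comp_apply, ContinuousLinearMap.neg_apply,
      ContinuousLinearMap.id_apply]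
    abel
  rw [e3]
  exact h3
end

section
/- Let X₁, …, X_m and Y₁, …, Y_r be smooth (C^∞) vector fields on ℝ^n such that each X_i is a C^∞(ℝ^n)-linear combination of Y₁, …, Y_r (i.e., X_i = Σ_j f_{ij} Y_j with each f_{ij} : ℝ^n → ℝ smooth) and each Y_j is a C^∞(ℝ^n)-linear combination of X₁, …, X_m. Then the bracket generating property does not depend on the choice of frame: for every point p ∈ ℝ^n, the ℝ-linear span of { V(p) : V an iterated Lie bracket of X₁,…,X_m } equals the ℝ-linear span of { W(p) : W an iterated Lie bracket of Y₁,…,Y_r }. -/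
inductive BrGen {n : ℕ} {ι : Type*} (Y : ι → (Fin n → ℝ) → (Fin n → ℝ)) :
    ((Fin n → ℝ) → (Fin n → ℝ)) → Prop
  | zero : BrGen Y 0
  | smul {a : (Fin n → ℝ) → ℝ} {V : (Fin n → ℝ) → (Fin n → ℝ)} :
      ContDiff ℝ (⊤ : ℕ∞) a → IsIteratedBracket Y V → BrGen Y (fun p => a p • V p)
  | add {V W : (Fin n → ℝ) → (Fin n → ℝ)} : BrGen Y V → BrGen Y W → BrGen Y (V + W)

section
variable {n : ℕ} {ι : Type*} {Y : ι → (Fin n → ℝ) → (Fin n → ℝ)}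

lemma IsIteratedBracket.smooth (hY : ∀ j, ContDiff ℝ (⊤ : ℕ∞) (Y j))
    {V : (Fin n → ℝ) → (Fin n → ℝ)} (h : IsIteratedBracket Y V) :
    ContDiff ℝ (⊤ : ℕ∞) V := by
  induction h with
  | base i => exact hY i
  | bracket _ _ h1 h2 => exact h1.lieBracket_vectorField h2 (by simp)

lemma BrGen.smooth (hY : ∀ j, ContDiff ℝ (⊤ : ℕ∞) (Y j))
    {V : (Fin n → ℝ) → (Fin n → ℝ)} (h : BrGen Y V) :
    ContDiff ℝ (⊤ : ℕ∞) V := by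
  induction h with
  | zero => exact contDiff_const
  | smul ha hV => exact ha.smul (hV.smooth hY)
  | add _ _ h1 h2 => exact h1.add h2

lemma smooth_diff {F : Type*} [NormedAddCommGroup F] [NormedSpace ℝ F] {V : (Fin n → ℝ) → F}
    (h : ContDiff ℝ (⊤ : ℕ∞) V) : Differentiable ℝ V :=
  h.differentiable (by simp)

lemma BrGen.of {V : (Fin n → ℝ) → (Fin n → ℝ)} (h : IsIteratedBracket Y V) : BrGen Y V := by
  have := BrGen.smul (Y := Y) (a := fun _ => 1) contDiff_const h
  simpa using this

lemma BrGen.smul' {V : (Fin n → ℝ) → (Fin n → ℝ)} (h : BrGen Y V)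
    {a : (Fin n → ℝ) → ℝ} (ha : ContDiff ℝ (⊤ : ℕ∞) a) : BrGen Y (fun p => a p • V p) := by
  induction h with
  | zero =>
    convert BrGen.zero (Y := Y) using 1
    ext p : 1
    simp
  | smul hb hV => simpa [smul_smul] using BrGen.smul (ha.mul hb) hV
  | add _ _ h1 h2 =>
    have := BrGen.add h1 h2
    convert this using 1
    ext p : 1
    simp

lemma smooth_lie {V : (Fin n → ℝ) → (Fin n → ℝ)} {b : (Fin n → ℝ) → ℝ}
    (hb : ContDiff ℝ (⊤ : ℕ∞) b) (hV : ContDiff ℝ (⊤ : ℕ∞) V) :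
    ContDiff ℝ (⊤ : ℕ∞) (fun p => fderiv ℝ b p (V p)) :=
  (hb.fderiv_right (m := (⊤ : ℕ∞)) (by simp)).clm_apply hV

lemma BrGen.bracket (hY : ∀ j, ContDiff ℝ (⊤ : ℕ∞) (Y j))
    {V W : (Fin n → ℝ) → (Fin n → ℝ)} (h : BrGen Y V) (h' : BrGen Y W) :
    BrGen Y (VectorField.lieBracket ℝ V W) := by
  induction h with
  | zero => simpa using BrGen.zero (Y := Y)
  | add h1 h2 i1 i2 =>
    convert BrGen.add i1 i2 using 1
    ext p : 1
    exact VectorField.lieBracket_add_left (smooth_diff (h1.smooth hY) p)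
      (smooth_diff (h2.smooth hY) p)
  | @smul a V ha hV =>
    have key : BrGen Y (VectorField.lieBracket ℝ V W) := by
      induction h' with
      | zero => simpa using BrGen.zero (Y := Y)
      | add h1 h2 i1 i2 =>
        convert BrGen.add i1 i2 using 1
        ext p : 1
        exact VectorField.lieBracket_add_right (smooth_diff (h1.smooth hY) p)
          (smooth_diff (h2.smooth hY) p)
      | @smul b W hb hW =>
        convert BrGen.add (BrGen.smul (smooth_lie hb (hV.smooth hY)) hW)
          (BrGen.smul hb (hV.bracket hW)) using 1
        ext p : 1
        exact VectorField.lieBracket_smul_right (smooth_diff hb p)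
          (smooth_diff (hW.smooth hY) p)
    convert BrGen.add (BrGen.smul (smooth_lie ha (h'.smooth hY)).neg hV)
      (key.smul' ha) using 1
    ext p : 1
    exact VectorField.lieBracket_smul_left (smooth_diff ha p)
      (smooth_diff (hV.smooth hY) p)

lemma BrGen.mem_span {V : (Fin n → ℝ) → (Fin n → ℝ)} (h : BrGen Y V) (p : Fin n → ℝ) :
    V p ∈ Submodule.span ℝ {w : Fin n → ℝ | ∃ W, IsIteratedBracket Y W ∧ W p = w} := by
  induction h with
  | zero => exact Submodule.zero_mem _
  | smul ha hV => exact Submodule.smul_mem _ _ (Submodule.subset_span ⟨_, hV, rfl⟩)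
  | add _ _ h1 h2 => exact Submodule.add_mem _ h1 h2

lemma BrGen.sum {κ : Type*} (s : Finset κ) (F : κ → (Fin n → ℝ) → (Fin n → ℝ))
    (h : ∀ k, BrGen Y (F k)) : BrGen Y (∑ k ∈ s, F k) := by
  classical
  induction s using Finset.induction_on with
  | empty => simpa using BrGen.zero (Y := Y)
  | insert k s hk ih => rw [Finset.sum_insert hk]; exact BrGen.add (h k) ih

lemma brGen_span_le {κ : Type*} [Fintype ι] {X : κ → (Fin n → ℝ) → (Fin n → ℝ)}
    (hY : ∀ j, ContDiff ℝ (⊤ : ℕ∞) (Y j))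
    (f : κ → ι → (Fin n → ℝ) → ℝ) (hf : ∀ i j, ContDiff ℝ (⊤ : ℕ∞) (f i j))
    (hXY : ∀ i, X i = fun p => ∑ j, f i j p • Y j p) (p : Fin n → ℝ) :
    Submodule.span ℝ {v : Fin n → ℝ | ∃ V, IsIteratedBracket X V ∧ V p = v} ≤
      Submodule.span ℝ {w : Fin n → ℝ | ∃ W, IsIteratedBracket Y W ∧ W p = w} := by
  rw [Submodule.span_le]
  rintro _ ⟨V, hV, rfl⟩
  refine BrGen.mem_span ?_ p
  induction hV with
  | base i =>
    convert BrGen.sum Finset.univ (fun j p => f i j p • Y j p)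
      (fun j => BrGen.smul (hf i j) (.base j)) using 1
    rw [hXY i]
    ext p : 1
    simp
  | bracket _ _ h1 h2 => exact h1.bracket hY h2

end

/-- The bracket generating property does not depend on the choice of frame: if two
families of smooth vector fields `X₁, …, X_m` and `Y₁, …, Y_r` on `ℝⁿ` are `C^∞`-linear
combinations of each other, then at every point the span of the values of all iterated
Lie brackets of the `X i` equals the span of the values of all iterated Lie brackets of
the `Y j`. -/
theorem bracket_generating_frame_independent {n m r : ℕ}
    (X : Fin m → (Fin n → ℝ) → (Fin n → ℝ))
    (Y : Fin r → (Fin n → ℝ) → (Fin n → ℝ))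
    (hX : ∀ i, ContDiff ℝ (⊤ : ℕ∞) (X i)) (hY : ∀ j, ContDiff ℝ (⊤ : ℕ∞) (Y j))
    (f : Fin m → Fin r → (Fin n → ℝ) → ℝ) (hf : ∀ i j, ContDiff ℝ (⊤ : ℕ∞) (f i j))
    (hXY : ∀ i, X i = fun p => ∑ j, f i j p • Y j p)
    (g : Fin r → Fin m → (Fin n → ℝ) → ℝ) (hg : ∀ j i, ContDiff ℝ (⊤ : ℕ∞) (g j i))
    (hYX : ∀ j, Y j = fun p => ∑ i, g j i p • X i p) :
    ∀ p : Fin n → ℝ,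
      Submodule.span ℝ {v : Fin n → ℝ | ∃ V, IsIteratedBracket X V ∧ V p = v} =
      Submodule.span ℝ {w : Fin n → ℝ | ∃ W, IsIteratedBracket Y W ∧ W p = w} := by
  intro p
  exact le_antisymm (brGen_span_le hY f hf hXY p) (brGen_span_le hX g hg hYX p)
end
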